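/- arXiv:2008.06257 — 5 statements merged into one kernel-verified Lean document; each statement's English description precedes it below -/
import Mathlib

section
/- For every C in C*Cat^nu the free ∗-algebra A^{f,alg}(C) is a pre-C*-algebra, and the functor A^f : C*Cat^nu → C*Alg^nu sending C to the completion of A^{f,alg}(C) with respect to the maximal semi-norm is left adjoint to the inclusion functor C*Alg^nu → C*Cat^nu which regards a possibly non-unital C*-algebra as a one-object C*-category. -/
noncomputable section

open scoped ENNReal

/-- A possibly non-unital ℂ-linear ∗-category. -/
structure StarCatNu : Type 1 where
  Obj : Type
  Hom : Obj → Obj → Type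
  [homAddCommGroup : ∀ X Y, AddCommGroup (Hom X Y)]
  [homModule : ∀ X Y, Module ℂ (Hom X Y)]
  comp : ∀ {X Y Z : Obj}, Hom Y Z → Hom X Y → Hom X Z
  star : ∀ {X Y : Obj}, Hom X Y → Hom Y X
  comp_assoc : ∀ {W X Y Z : Obj} (h : Hom Y Z) (g : Hom X Y) (f : Hom W X),
    comp (comp h g) f = comp h (comp g f)
  add_comp : ∀ {X Y Z : Obj} (g g' : Hom Y Z) (f : Hom X Y),
    comp (g + g') f = comp g f + comp g' f
  comp_add : ∀ {X Y Z : Obj} (g : Hom Y Z) (f f' : Hom X Y),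
    comp g (f + f') = comp g f + comp g f'
  smul_comp : ∀ {X Y Z : Obj} (c : ℂ) (g : Hom Y Z) (f : Hom X Y),
    comp (c • g) f = c • comp g f
  comp_smul : ∀ {X Y Z : Obj} (c : ℂ) (g : Hom Y Z) (f : Hom X Y),
    comp g (c • f) = c • comp g f
  star_star : ∀ {X Y : Obj} (f : Hom X Y), star (star f) = f
  star_comp : ∀ {X Y Z : Obj} (g : Hom Y Z) (f : Hom X Y),
    star (comp g f) = comp (star f) (star g)
  star_add : ∀ {X Y : Obj} (f f' : Hom X Y), star (f + f') = star f + star f'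
  star_smul : ∀ {X Y : Obj} (c : ℂ) (f : Hom X Y),
    star (c • f) = (starRingEnd ℂ) c • star f

attribute [instance] StarCatNu.homAddCommGroup StarCatNu.homModule

namespace StarCatNu

/-- Transport of morphisms along equalities of objects. -/
def castHom (C : StarCatNu) {X X' Y Y' : C.Obj} (hX : X = X') (hY : Y = Y')
    (f : C.Hom X Y) : C.Hom X' Y' := hX ▸ hY ▸ f

theorem comp_zero (C : StarCatNu) {X Y Z : C.Obj} (g : C.Hom Y Z) :
    C.comp g (0 : C.Hom X Y) = 0 :=
  (AddMonoidHom.mk' (fun f : C.Hom X Y => C.comp g f) (C.comp_add g)).map_zero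

theorem zero_comp (C : StarCatNu) {X Y Z : C.Obj} (f : C.Hom X Y) :
    C.comp (0 : C.Hom Y Z) f = 0 :=
  (AddMonoidHom.mk' (fun g : C.Hom Y Z => C.comp g f) (fun a b => C.add_comp a b f)).map_zero

theorem star_zero' (C : StarCatNu) {X Y : C.Obj} :
    C.star (0 : C.Hom X Y) = 0 :=
  (AddMonoidHom.mk' (fun f : C.Hom X Y => C.star f) C.star_add).map_zero

end StarCatNu

/-- A (not necessarily unit-preserving) functor between possibly non-unital ℂ-linear
∗-categories, compatible with the enrichment and the involutions. -/
structure StarFunctor (C D : StarCatNu) where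
  obj : C.Obj → D.Obj
  map : ∀ {X Y : C.Obj}, C.Hom X Y → D.Hom (obj X) (obj Y)
  map_add : ∀ (X Y : C.Obj) (f f' : C.Hom X Y), map (f + f') = map f + map f'
  map_smul : ∀ (X Y : C.Obj) (c : ℂ) (f : C.Hom X Y), map (c • f) = c • map f
  map_comp : ∀ (X Y Z : C.Obj) (g : C.Hom Y Z) (f : C.Hom X Y),
    map (C.comp g f) = D.comp (map g) (map f)
  map_star : ∀ (X Y : C.Obj) (f : C.Hom X Y), map (C.star f) = D.star (map f)

namespace StarFunctor

theorem map_zero {C D : StarCatNu} (F : StarFunctor C D) (X Y : C.Obj) :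
    F.map (0 : C.Hom X Y) = 0 :=
  (AddMonoidHom.mk' (fun f : C.Hom X Y => F.map f) (F.map_add X Y)).map_zero

/-- The identity functor. -/
def id (C : StarCatNu) : StarFunctor C C where
  obj X := X
  map f := f
  map_add _ _ _ _ := rfl
  map_smul _ _ _ _ := rfl
  map_comp _ _ _ _ _ := rfl
  map_star _ _ _ := rfl

/-- Composition of functors: first `F`, then `G`. -/
def comp {C D E : StarCatNu} (F : StarFunctor C D) (G : StarFunctor D E) :
    StarFunctor C E where
  obj X := G.obj (F.obj X)
  map f := G.map (F.map f)
  map_add X Y f f' := by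
    show G.map (F.map (f + f')) = G.map (F.map f) + G.map (F.map f')
    rw [F.map_add, G.map_add]
  map_smul X Y c f := by
    show G.map (F.map (c • f)) = c • G.map (F.map f)
    rw [F.map_smul, G.map_smul]
  map_comp X Y Z g f := by
    show G.map (F.map (C.comp g f)) = E.comp (G.map (F.map g)) (G.map (F.map f))
    rw [F.map_comp, G.map_comp]
  map_star X Y f := by
    show G.map (F.map (C.star f)) = E.star (G.map (F.map f))
    rw [F.map_star, G.map_star]

end StarFunctor

instance : CategoryTheory.Category StarCatNu where
  Hom := StarFunctor
  id := StarFunctor.id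
  comp := StarFunctor.comp
  id_comp := by intros; rfl
  comp_id := by intros; rfl
  assoc := by intros; rfl
/-- A possibly non-unital ∗-algebra over ℂ regarded as a ℂ-linear ∗-category with a
single object. -/
def StarCatNu.ofAlgebra (B : Type) [NonUnitalRing B] [Module ℂ B]
    [SMulCommClass ℂ B B] [IsScalarTower ℂ B B] [StarRing B] [StarModule ℂ B] :
    StarCatNu where
  Obj := PUnit
  Hom _ _ := B
  comp g f := g * f
  star b := Star.star b
  comp_assoc h g f := mul_assoc h g f
  add_comp g g' f := add_mul g g' f
  comp_add g f f' := mul_add g f f'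
  smul_comp c g f := smul_mul_assoc c g f
  comp_smul c g f := mul_smul_comm c g f
  star_star f := InvolutiveStar.star_involutive f
  star_comp g f := StarMul.star_mul g f
  star_add f f' := StarAddMonoid.star_add f f'
  star_smul c f := by
    show Star.star (c • f) = (starRingEnd ℂ) c • Star.star f
    rw [StarModule.star_smul, starRingEnd_apply]

/-- The maximal semi-norm of a morphism in a possibly non-unital ℂ-linear ∗-category:
the supremum of `‖ρ f‖` over all morphisms `ρ` into C*-algebras regarded as one-object
ℂ-linear ∗-categories. -/
noncomputable def StarCatNu.repNorm (C : StarCatNu) {X Y : C.Obj} (f : C.Hom X Y)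
    (B : Type) [NonUnitalCStarAlgebra B] (ρ : StarFunctor C (StarCatNu.ofAlgebra B)) : ℝ≥0∞ :=
  (‖id (α := B) (ρ.map f)‖₊ : ℝ≥0∞)

noncomputable def StarCatNu.maxNorm (C : StarCatNu) {X Y : C.Obj} (f : C.Hom X Y) : ℝ≥0∞ :=
  sSup { r : ℝ≥0∞ | ∃ (B : Type) (i : NonUnitalCStarAlgebra B)
    (ρ : StarFunctor C (StarCatNu.ofAlgebra B)), r = @StarCatNu.repNorm C X Y f B i ρ }

/-- A pre-C*-category: all morphisms have finite maximal semi-norm. -/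
def IsPreCStar (C : StarCatNu) : Prop :=
  ∀ (X Y : C.Obj) (f : C.Hom X Y), C.maxNorm f < ⊤

/-- A C*-category: the maximal semi-norm is a finite norm and the morphism spaces are
complete with respect to it (completeness is expressed via Cauchy sequences). -/
def IsCStar (C : StarCatNu) : Prop :=
  IsPreCStar C ∧
  (∀ (X Y : C.Obj) (f : C.Hom X Y), C.maxNorm f = 0 → f = 0) ∧
  (∀ (X Y : C.Obj) (u : ℕ → C.Hom X Y),
    (∀ ε : ℝ≥0∞, 0 < ε → ∃ N, ∀ m ≥ N, ∀ n ≥ N, C.maxNorm (u m - u n) < ε) →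
    ∃ f : C.Hom X Y, ∀ ε : ℝ≥0∞, 0 < ε → ∃ N, ∀ n ≥ N, C.maxNorm (u n - f) < ε)

/-- `e` is an identity morphism at its object. -/
def IsIdentityAt (C : StarCatNu) {X : C.Obj} (e : C.Hom X X) : Prop :=
  (∀ (Y : C.Obj) (f : C.Hom X Y), C.comp f e = f) ∧
  (∀ (Y : C.Obj) (g : C.Hom Y X), C.comp e g = g)

/-- A ℂ-linear ∗-category is unital if every object admits an identity morphism. -/
def StarCatNu.IsUnital (C : StarCatNu) : Prop :=
  ∀ X : C.Obj, ∃ e : C.Hom X X, IsIdentityAt C e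

/-- A functor is unital if it sends identity morphisms to identity morphisms. -/
def StarFunctor.Unital {C D : StarCatNu} (F : StarFunctor C D) : Prop :=
  ∀ (X : C.Obj) (e : C.Hom X X), IsIdentityAt C e → IsIdentityAt D (F.map e)

/-- A morphism `u` is unitary if `u* ∘ u` and `u ∘ u*` are identity morphisms. -/
def IsUnitary (D : StarCatNu) {A B : D.Obj} (u : D.Hom A B) : Prop :=
  IsIdentityAt D (D.comp (D.star u) u) ∧ IsIdentityAt D (D.comp u (D.star u))

/-- A unitary natural transformation between two functors. -/
structure UnitaryTrans {C D : StarCatNu} (F G : StarFunctor C D) where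
  app : ∀ X : C.Obj, D.Hom (F.obj X) (G.obj X)
  natural : ∀ (X Y : C.Obj) (f : C.Hom X Y),
    D.comp (app Y) (F.map f) = D.comp (G.map f) (app X)
  unitary : ∀ X : C.Obj, IsUnitary D (app X)

/-- A functor is a unitary equivalence if it is invertible up to unitary isomorphism. -/
def IsUnitaryEquiv {C D : StarCatNu} (F : StarFunctor C D) : Prop :=
  ∃ H : StarFunctor D C,
    Nonempty (UnitaryTrans (F.comp H) (StarFunctor.id C)) ∧
    Nonempty (UnitaryTrans (H.comp F) (StarFunctor.id D))

/-- A quotient morphism: bijective on objects and surjective on all morphism spaces. -/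
def IsQuotientHom {C D : StarCatNu} (F : StarFunctor C D) : Prop :=
  Function.Bijective F.obj ∧
  ∀ (X Y : C.Obj), Function.Surjective (fun f : C.Hom X Y => F.map f)

/-- An exact sequence `0 → C → D → Q → 0`: `p` is a quotient morphism and `i` is the
inclusion of its kernel. -/
structure IsExactSeq {C D Q : StarCatNu} (i : StarFunctor C D) (p : StarFunctor D Q) : Prop where
  i_obj_bij : Function.Bijective i.obj
  i_map_inj : ∀ (X Y : C.Obj), Function.Injective (fun f : C.Hom X Y => i.map f)
  p_quot : IsQuotientHom p
  exact : ∀ (X Y : C.Obj) (f : D.Hom (i.obj X) (i.obj Y)),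
    p.map f = 0 ↔ ∃ g : C.Hom X Y, i.map g = f

/-- `ι : C → Cc` exhibits the C*-category `Cc` as the completion of the pre-C*-category `C`
with respect to the maximal semi-norm. -/
structure IsCompletion (C Cc : StarCatNu) (ι : StarFunctor C Cc) : Prop where
  pre : IsPreCStar C
  cstar : IsCStar Cc
  obj_bij : Function.Bijective ι.obj
  isometric : ∀ (X Y : C.Obj) (f : C.Hom X Y), Cc.maxNorm (ι.map f) = C.maxNorm f
  dense : ∀ (X Y : C.Obj) (h : Cc.Hom (ι.obj X) (ι.obj Y)) (ε : ℝ≥0∞), 0 < ε →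
    ∃ f : C.Hom X Y, Cc.maxNorm (h - ι.map f) < ε

/-- The maximal semi-norm of an element of a possibly non-unital ∗-algebra over ℂ:
the supremum of `‖φ x‖` over all ∗-homomorphisms `φ` into C*-algebras. -/
noncomputable def algRepNorm (R : Type) [NonUnitalRing R] [Module ℂ R]
    [SMulCommClass ℂ R R] [IsScalarTower ℂ R R] [StarRing R] [StarModule ℂ R]
    (x : R) (B : Type) [NonUnitalCStarAlgebra B] (φ : R →⋆ₙₐ[ℂ] B) : ℝ≥0∞ :=
  (‖φ x‖₊ : ℝ≥0∞)

/-- The maximal semi-norm on a ∗-algebra over ℂ. -/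
noncomputable def algMaxNorm (R : Type) [NonUnitalRing R] [Module ℂ R]
    [SMulCommClass ℂ R R] [IsScalarTower ℂ R R] [StarRing R] [StarModule ℂ R]
    (x : R) : ℝ≥0∞ :=
  sSup { r : ℝ≥0∞ | ∃ (B : Type) (i : NonUnitalCStarAlgebra B) (φ : R →⋆ₙₐ[ℂ] B),
    r = @algRepNorm R _ _ _ _ _ _ x B i φ }

/-- A ∗-algebra over ℂ is a pre-C*-algebra if all its elements have finite maximal
semi-norm. -/
def IsPreCStarAlg (R : Type) [NonUnitalRing R] [Module ℂ R]
    [SMulCommClass ℂ R R] [IsScalarTower ℂ R R] [StarRing R] [StarModule ℂ R] : Prop :=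
  ∀ x : R, algMaxNorm R x < ⊤

/-- `j : R → R̄` exhibits the C*-algebra `R̄` as the completion of the pre-C*-algebra `R`
with respect to the maximal semi-norm. -/
structure IsAlgCompletion (R : Type) [NonUnitalRing R] [Module ℂ R]
    [SMulCommClass ℂ R R] [IsScalarTower ℂ R R] [StarRing R] [StarModule ℂ R]
    (R' : Type) [NonUnitalCStarAlgebra R'] (j : R →⋆ₙₐ[ℂ] R') : Prop where
  isometric : ∀ x : R, (‖j x‖₊ : ℝ≥0∞) = algMaxNorm R x
  dense : DenseRange j

/-- `A`, together with the canonical morphism `δ : C → A` (a morphism of ℂ-linear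
∗-categories into `A` regarded as a one-object category), is the free ∗-algebra over ℂ
generated by the morphisms of `C` subject to the relations given by the compositions in
`C`, the ∗-operation, and the linear structure of the morphism spaces: it is initial
among morphisms from `C` to ∗-algebras over ℂ. -/
structure IsFreeStarAlgebraOn (C : StarCatNu) (A : Type) [NonUnitalRing A] [Module ℂ A]
    [SMulCommClass ℂ A A] [IsScalarTower ℂ A A] [StarRing A] [StarModule ℂ A]
    (δ : StarFunctor C (StarCatNu.ofAlgebra A)) : Prop where
  universal : ∀ (B : Type) [NonUnitalRing B] [Module ℂ B] [SMulCommClass ℂ B B]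
    [IsScalarTower ℂ B B] [StarRing B] [StarModule ℂ B]
    (σ : StarFunctor C (StarCatNu.ofAlgebra B)),
    ∃! φ : A →⋆ₙₐ[ℂ] B, ∀ (X Y : C.Obj) (f : C.Hom X Y),
      φ (id (α := A) (δ.map f)) = id (α := B) (σ.map f)

/-- Finiteness of the maximal semi-norm as a uniform bound. -/
def AlgBdd (R : Type) [NonUnitalRing R] [Module ℂ R]
    [SMulCommClass ℂ R R] [IsScalarTower ℂ R R] [StarRing R] [StarModule ℂ R] (x : R) : Prop :=
  ∃ K : ℝ, 0 ≤ K ∧ ∀ (B : Type) [NonUnitalCStarAlgebra B] (φ : R →⋆ₙₐ[ℂ] B), ‖φ x‖ ≤ K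

/-- The ∗-subalgebra of elements with finite maximal semi-norm. -/
def bddSubalgebra (R : Type) [NonUnitalRing R] [Module ℂ R]
    [SMulCommClass ℂ R R] [IsScalarTower ℂ R R] [StarRing R] [StarModule ℂ R] :
    NonUnitalStarSubalgebra ℂ R where
  carrier := {x | AlgBdd R x}
  add_mem' := by
    rintro a b ⟨K, hK, h⟩ ⟨L, hL, h'⟩
    refine ⟨K + L, by positivity, fun B _ φ => ?_⟩
    rw [map_add]
    exact (norm_add_le _ _).trans (add_le_add (h B φ) (h' B φ))
  zero_mem' := ⟨0, le_rfl, fun B _ φ => by rw [map_zero, norm_zero]⟩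
  mul_mem' := by
    rintro a b ⟨K, hK, h⟩ ⟨L, hL, h'⟩
    refine ⟨K * L, by positivity, fun B _ φ => ?_⟩
    rw [map_mul]
    exact (norm_mul_le _ _).trans (mul_le_mul (h B φ) (h' B φ) (norm_nonneg _) hK)
  smul_mem' := by
    rintro c a ⟨K, hK, h⟩
    refine ⟨‖c‖ * K, by positivity, fun B _ φ => ?_⟩
    rw [map_smul, norm_smul]
    exact mul_le_mul_of_nonneg_left (h B φ) (norm_nonneg _)
  star_mem' := by
    rintro a ⟨K, hK, h⟩
    refine ⟨K, hK, fun B _ φ => ?_⟩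
    rw [map_star, norm_star]
    exact h B φ

theorem algMaxNorm_lt_top_of_bdd {R : Type} [NonUnitalRing R] [Module ℂ R]
    [SMulCommClass ℂ R R] [IsScalarTower ℂ R R] [StarRing R] [StarModule ℂ R] {x : R}
    (h : AlgBdd R x) : algMaxNorm R x < ⊤ := by
  obtain ⟨K, hK, h⟩ := h
  refine lt_of_le_of_lt (sSup_le ?_) (ENNReal.coe_lt_top (r := ⟨K, hK⟩))
  rintro r ⟨B, i, φ, rfl⟩
  exact ENNReal.coe_le_coe.2 (h B φ)

theorem le_algMaxNorm {R : Type} [NonUnitalRing R] [Module ℂ R]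
    [SMulCommClass ℂ R R] [IsScalarTower ℂ R R] [StarRing R] [StarModule ℂ R] (x : R)
    (B : Type) [i : NonUnitalCStarAlgebra B] (φ : R →⋆ₙₐ[ℂ] B) :
    (‖φ x‖₊ : ℝ≥0∞) ≤ algMaxNorm R x :=
  le_sSup ⟨B, i, φ, rfl⟩

/-- Post-composition of a functor into a ∗-algebra with a ∗-homomorphism. -/
def StarFunctor.postcomp {C : StarCatNu} {A B : Type} [NonUnitalRing A] [Module ℂ A]
    [SMulCommClass ℂ A A] [IsScalarTower ℂ A A] [StarRing A] [StarModule ℂ A]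
    [NonUnitalRing B] [Module ℂ B]
    [SMulCommClass ℂ B B] [IsScalarTower ℂ B B] [StarRing B] [StarModule ℂ B]
    (δ : StarFunctor C (StarCatNu.ofAlgebra A)) (φ : A →⋆ₙₐ[ℂ] B) :
    StarFunctor C (StarCatNu.ofAlgebra B) where
  obj _ := PUnit.unit
  map f := φ (_root_.id (α := A) (δ.map f))
  map_add X Y f g := by
    rw [δ.map_add]; exact _root_.map_add φ _ _
  map_smul X Y c f := by
    rw [δ.map_smul]; exact _root_.map_smul φ _ _
  map_comp X Y Z g f := by
    rw [δ.map_comp]; exact _root_.map_mul φ _ _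
  map_star X Y f := by
    rw [δ.map_star]; exact StarHomClass.map_star φ _

/-- Corestriction of a functor to a ∗-subalgebra. -/
def StarFunctor.corestrict {C : StarCatNu} {A : Type} [NonUnitalRing A] [Module ℂ A]
    [SMulCommClass ℂ A A] [IsScalarTower ℂ A A] [StarRing A] [StarModule ℂ A]
    (δ : StarFunctor C (StarCatNu.ofAlgebra A)) (S : NonUnitalStarSubalgebra ℂ A)
    (hS : ∀ (X Y : C.Obj) (f : C.Hom X Y), _root_.id (α := A) (δ.map f) ∈ S) :
    StarFunctor C (StarCatNu.ofAlgebra S) where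
  obj _ := PUnit.unit
  map f := (⟨_root_.id (α := A) (δ.map f), hS _ _ f⟩ : S)
  map_add X Y f g := Subtype.ext (δ.map_add X Y f g)
  map_smul X Y c f := Subtype.ext (δ.map_smul X Y c f)
  map_comp X Y Z g f := Subtype.ext (δ.map_comp X Y Z g f)
  map_star X Y f := Subtype.ext (δ.map_star X Y f)

theorem bdd_generator {C : StarCatNu} (hC : IsPreCStar C) {A : Type} [NonUnitalRing A]
    [Module ℂ A] [SMulCommClass ℂ A A] [IsScalarTower ℂ A A] [StarRing A] [StarModule ℂ A]
    (δ : StarFunctor C (StarCatNu.ofAlgebra A)) (X Y : C.Obj) (f : C.Hom X Y) :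
    AlgBdd A (id (α := A) (δ.map f)) := by
  refine ⟨(C.maxNorm f).toReal, ENNReal.toReal_nonneg, fun B i φ => ?_⟩
  have h : (‖φ (id (α := A) (δ.map f))‖₊ : ℝ≥0∞) ≤ C.maxNorm f :=
    le_sSup ⟨B, i, δ.postcomp φ, rfl⟩
  exact ENNReal.toReal_mono (hC X Y f).ne h

theorem free_bdd {C : StarCatNu} (hC : IsPreCStar C) {A : Type} [NonUnitalRing A]
    [Module ℂ A] [SMulCommClass ℂ A A] [IsScalarTower ℂ A A] [StarRing A] [StarModule ℂ A]
    (δ : StarFunctor C (StarCatNu.ofAlgebra A)) (hA : IsFreeStarAlgebraOn C A δ) (x : A) :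
    AlgBdd A x := by
  obtain ⟨φ, hφ, -⟩ := hA.universal (bddSubalgebra A)
    (δ.corestrict (bddSubalgebra A) (bdd_generator hC δ))
  obtain ⟨ψ, hψ, hu⟩ := hA.universal A δ
  have h1 : (NonUnitalStarSubalgebraClass.subtype (bddSubalgebra A)).comp φ = ψ :=
    hu _ fun X Y f => congrArg Subtype.val (hφ X Y f)
  have h2 : NonUnitalStarAlgHom.id ℂ A = ψ := hu _ fun X Y f => rfl
  have h3 : ((φ x : bddSubalgebra A) : A) = x := DFunLike.congr_fun (h1.trans h2.symm) x
  rw [← h3]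
  exact (φ x).2

/-- Extension of a bounded ∗-homomorphism along a dense ∗-homomorphism. -/
theorem exists_extension {A : Type} [NonUnitalRing A]
    [Module ℂ A] [SMulCommClass ℂ A A] [IsScalarTower ℂ A A] [StarRing A] [StarModule ℂ A]
    {A' B : Type} [NonUnitalCStarAlgebra A'] [NonUnitalCStarAlgebra B]
    (j : A →⋆ₙₐ[ℂ] A') (hj : DenseRange j) (ψ : A →⋆ₙₐ[ℂ] B) (h : ∀ x, ‖ψ x‖ ≤ ‖j x‖) :
    ∃ φ : A' →⋆ₙₐ[ℂ] B, ∀ x, φ (j x) = ψ x := by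
  let e : A →ₗ[ℂ] A' :=
    { toFun := j, map_add' := map_add j, map_smul' := map_smul j }
  let f : A →ₗ[ℂ] B :=
    { toFun := ψ, map_add' := map_add ψ, map_smul' := map_smul ψ }
  let g : A' →L[ℂ] B := f.extendOfNorm e
  have hg : ∀ x, g (j x) = ψ x := fun x =>
    LinearMap.extendOfNorm_eq (f := f) (e := e) hj ⟨1, fun x => by simpa using! h x⟩ x
  have hmul : ∀ a b, g (a * b) = g a * g b := by
    intro a b
    refine hj.induction_on₂ (p := fun a b => g (a * b) = g a * g b) ?_ ?_ a b
    · exact isClosed_eq (by fun_prop) (by fun_prop)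
    · intro x y
      rw [← map_mul, hg, hg, hg, map_mul]
  have hstar : ∀ a, g (star a) = star (g a) := by
    intro a
    refine hj.induction_on (p := fun a => g (star a) = star (g a)) a ?_ ?_
    · exact isClosed_eq (by fun_prop) (by fun_prop)
    · intro x
      rw [← map_star, hg, hg, map_star]
  exact ⟨{ toFun := g, map_smul' := map_smul g, map_zero' := map_zero g, map_add' := map_add g,
           map_mul' := hmul, map_star' := hstar }, hg⟩

/-- For every C*-category `C` the free ∗-algebra `A^{f,alg}(C)` is a
pre-C*-algebra, and the functor `A^f : C*Cat^nu → C*Alg^nu` sending `C` to the completion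
of `A^{f,alg}(C)` with respect to the maximal semi-norm is left adjoint to the inclusion
functor `C*Alg^nu → C*Cat^nu` regarding a possibly non-unital C*-algebra as a one-object
C*-category.  (Adjointness is expressed through the universal property of the unit
`C → A^{f,alg}(C) → A^f(C)`.) -/
theorem free_cstar_algebra_adjunction
    (C : StarCatNu) (hC : IsCStar C)
    (A : Type) [NonUnitalRing A] [Module ℂ A] [SMulCommClass ℂ A A]
    [IsScalarTower ℂ A A] [StarRing A] [StarModule ℂ A]
    (δ : StarFunctor C (StarCatNu.ofAlgebra A)) (hA : IsFreeStarAlgebraOn C A δ) :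
    IsPreCStarAlg A ∧
    ∀ (A' : Type) [NonUnitalCStarAlgebra A'] (j : A →⋆ₙₐ[ℂ] A'),
      IsAlgCompletion A A' j →
      ∀ (B : Type) [NonUnitalCStarAlgebra B] (σ : StarFunctor C (StarCatNu.ofAlgebra B)),
        ∃! φ : A' →⋆ₙₐ[ℂ] B, ∀ (X Y : C.Obj) (f : C.Hom X Y),
          φ (j (id (α := A) (δ.map f))) = id (α := B) (σ.map f) := by
  refine ⟨fun x => algMaxNorm_lt_top_of_bdd (free_bdd hC.1 δ hA x), ?_⟩
  intro A' _ j hj B _ σ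
  obtain ⟨ψ, hψ, hu⟩ := hA.universal B σ
  obtain ⟨φ, hφ⟩ := exists_extension j hj.dense ψ fun x => by
    have h := le_algMaxNorm x B ψ
    rw [← hj.isometric x] at h
    exact ENNReal.coe_le_coe.1 h
  refine ⟨φ, fun X Y f => (hφ _).trans (hψ X Y f), fun φ' h' => ?_⟩
  have h1 : φ'.comp j = ψ := hu _ fun X Y f => h' X Y f
  have c : ∀ χ : A' →⋆ₙₐ[ℂ] B, Continuous χ := fun χ =>
    AddMonoidHomClass.continuous_of_bound χ 1 fun x => by
      rw [one_mul]; exact NonUnitalStarAlgHom.norm_apply_le χ x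
  have h2 : (φ' : A' → B) = φ := hj.dense.equalizer (c φ') (c φ) (funext fun x =>
    (DFunLike.congr_fun h1 x).trans (hφ x).symm)
  exact DFunLike.coe_injective h2
end
end

section
/- Let G be a group and C a possibly non-unital small C*-category with G-action. Then the algebraic crossed product C⋊^alg G is a pre-C*-category; more precisely, for every morphism f of C and every g ∈ G one has ‖(f,g)‖_max ≤ ‖f‖_C. -/
noncomputable section

open scoped ENNReal

/-- An action of a group `G` on a possibly non-unital ℂ-linear ∗-category `C` by
automorphisms (an object of `Fun(BG, ∗Cat^nu_ℂ)`). -/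
structure GAction (G : Type) [Group G] (C : StarCatNu) where
  actObj : G → C.Obj → C.Obj
  actMap : ∀ (g : G) {X Y : C.Obj}, C.Hom X Y → C.Hom (actObj g X) (actObj g Y)
  one_obj : ∀ X : C.Obj, actObj 1 X = X
  mul_obj : ∀ (g h : G) (X : C.Obj), actObj g (actObj h X) = actObj (g * h) X
  one_map : ∀ (X Y : C.Obj) (f : C.Hom X Y),
    C.castHom (one_obj X) (one_obj Y) (actMap 1 f) = f
  mul_map : ∀ (g h : G) (X Y : C.Obj) (f : C.Hom X Y),
    C.castHom (mul_obj g h X) (mul_obj g h Y) (actMap g (actMap h f)) = actMap (g * h) f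
  map_add : ∀ (g : G) (X Y : C.Obj) (f f' : C.Hom X Y),
    actMap g (f + f') = actMap g f + actMap g f'
  map_smul : ∀ (g : G) (X Y : C.Obj) (c : ℂ) (f : C.Hom X Y),
    actMap g (c • f) = c • actMap g f
  map_comp : ∀ (g : G) (X Y Z : C.Obj) (u : C.Hom Y Z) (f : C.Hom X Y),
    actMap g (C.comp u f) = C.comp (actMap g u) (actMap g f)
  map_star : ∀ (g : G) (X Y : C.Obj) (f : C.Hom X Y),
    actMap g (C.star f) = C.star (actMap g f)

namespace GAction

variable {G : Type} [Group G] {C : StarCatNu}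

/-- The automorphism of `C` given by the action of `g`. -/
def functor (α : GAction G C) (g : G) : StarFunctor C C where
  obj := α.actObj g
  map := α.actMap g
  map_add := α.map_add g
  map_smul := α.map_smul g
  map_comp := α.map_comp g
  map_star := α.map_star g

theorem inv_mul_obj (α : GAction G C) (g g' : G) (Z : C.Obj) :
    α.actObj g⁻¹ (α.actObj g'⁻¹ Z) = α.actObj (g' * g)⁻¹ Z := by
  rw [α.mul_obj, mul_inv_rev]

theorem cancel_obj (α : GAction G C) (g : G) (Y : C.Obj) :
    α.actObj g (α.actObj g⁻¹ Y) = Y := by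
  rw [α.mul_obj, mul_inv_cancel, α.one_obj]

theorem inv_inv_obj (α : GAction G C) (g : G) (X : C.Obj) :
    α.actObj g⁻¹⁻¹ X = α.actObj g X := by rw [inv_inv]

theorem one_inv_obj (α : GAction G C) (Y : C.Obj) :
    α.actObj (1 : G)⁻¹ Y = Y := by rw [inv_one, α.one_obj]

theorem lc_obj (α : GAction G C) (a b : G) (Y : C.Obj) :
    α.actObj a⁻¹ Y = α.actObj (b⁻¹ * a)⁻¹ (α.actObj b⁻¹ Y) := by
  rw [α.mul_obj]
  congr 1
  group

end GAction

/-- `CG` together with the data `obj`, `ins` is a realization of the algebraic crossed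
product `C ⋊^alg G`: its objects are those of `C`, its morphism spaces are the direct sums
`⊕_{g ∈ G} Hom_C(X, g⁻¹Y)` (the element of the `g`-th summand corresponding to `f` being
`ins g f`, i.e. `(f, g)`), with composition `(f', g') ∘ (f, g) = (g⁻¹f' ∘ f, g'g)` and
involution `(f, g)* = (g f*, g⁻¹)`. -/
structure IsCrossedProductAlg (G : Type) [Group G] (C : StarCatNu) (α : GAction G C)
    (CG : StarCatNu) where
  obj : C.Obj → CG.Obj
  obj_bij : Function.Bijective obj
  ins : ∀ (g : G) {X Y : C.Obj}, C.Hom X (α.actObj g⁻¹ Y) → CG.Hom (obj X) (obj Y)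
  ins_add : ∀ (g : G) (X Y : C.Obj) (f f' : C.Hom X (α.actObj g⁻¹ Y)),
    ins g (f + f') = ins g f + ins g f'
  ins_smul : ∀ (g : G) (X Y : C.Obj) (c : ℂ) (f : C.Hom X (α.actObj g⁻¹ Y)),
    ins g (c • f) = c • ins g f
  ins_comp : ∀ (g g' : G) (X Y Z : C.Obj)
    (f : C.Hom X (α.actObj g⁻¹ Y)) (f' : C.Hom Y (α.actObj g'⁻¹ Z)),
    CG.comp (ins g' f') (ins g f) =
      ins (g' * g) (C.castHom rfl (α.inv_mul_obj g g' Z)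
        (C.comp (α.actMap g⁻¹ f') f))
  ins_star : ∀ (g : G) (X Y : C.Obj) (f : C.Hom X (α.actObj g⁻¹ Y)),
    CG.star (ins g f) =
      ins g⁻¹ (C.castHom (α.cancel_obj g Y) (α.inv_inv_obj g X).symm
        (α.actMap g (C.star f)))
  span : ∀ (X Y : C.Obj) (u : CG.Hom (obj X) (obj Y)),
    ∃ (s : Finset G) (φ : ∀ g : G, C.Hom X (α.actObj g⁻¹ Y)),
      u = s.sum fun g => ins g (φ g)
  indep : ∀ (X Y : C.Obj) (s : Finset G) (φ : ∀ g : G, C.Hom X (α.actObj g⁻¹ Y)),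
    (s.sum fun g => ins g (φ g)) = 0 → ∀ g ∈ s, φ g = 0

theorem castHom_heq_self (C : StarCatNu) {X X' Y Y' : C.Obj} (hX : X = X') (hY : Y = Y')
    (f : C.Hom X Y) : HEq (C.castHom hX hY f) f := by
  subst hX; subst hY; rfl

theorem comp_heq_of_heq (C : StarCatNu) {X X' Y Y' Z Z' : C.Obj} (hX : X = X') (hY : Y = Y')
    (hZ : Z = Z') {g : C.Hom Y Z} {g' : C.Hom Y' Z'} {f : C.Hom X Y} {f' : C.Hom X' Y'}
    (hg : HEq g g') (hf : HEq f f') : HEq (C.comp g f) (C.comp g' f') := by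
  subst hX; subst hY; subst hZ; cases hg; cases hf; rfl

theorem star_heq_of_heq (C : StarCatNu) {X X' Y Y' : C.Obj} (hX : X = X') (hY : Y = Y')
    {f : C.Hom X Y} {f' : C.Hom X' Y'} (hf : HEq f f') : HEq (C.star f) (C.star f') := by
  subst hX; subst hY; cases hf; rfl

theorem castHom_add_eq (C : StarCatNu) {X X' Y Y' : C.Obj} (hX : X = X') (hY : Y = Y')
    (f f' : C.Hom X Y) :
    C.castHom hX hY (f + f') = C.castHom hX hY f + C.castHom hX hY f' := by
  subst hX; subst hY; rfl

theorem castHom_smul_eq (C : StarCatNu) {X X' Y Y' : C.Obj} (hX : X = X') (hY : Y = Y')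
    (c : ℂ) (f : C.Hom X Y) :
    C.castHom hX hY (c • f) = c • C.castHom hX hY f := by
  subst hX; subst hY; rfl

section
variable {G : Type} [Group G] {C : StarCatNu}

theorem actMap_heq_of_heq (α : GAction G C) {g g' : G} (hg : g = g') {X X' Y Y' : C.Obj}
    (hX : X = X') (hY : Y = Y') {f : C.Hom X Y} {f' : C.Hom X' Y'} (hf : HEq f f') :
    HEq (α.actMap g f) (α.actMap g' f') := by
  subst hg; subst hX; subst hY; cases hf; rfl

theorem actMap_one_heq (α : GAction G C) {g : G} (hg : g = 1) {X Y : C.Obj} (f : C.Hom X Y) :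
    HEq (α.actMap g f) f := by
  subst hg
  have h1 := castHom_heq_self C (α.one_obj X) (α.one_obj Y) (α.actMap 1 f)
  rw [α.one_map] at h1
  exact h1.symm

theorem actMap_mul_heq (α : GAction G C) (g k : G) {X Y : C.Obj} (f : C.Hom X Y) :
    HEq (α.actMap g (α.actMap k f)) (α.actMap (g * k) f) := by
  rw [← α.mul_map]
  exact (castHom_heq_self C _ _ _).symm

variable {α : GAction G C} {CG : StarCatNu}

theorem ins_eq_of_heq (h : IsCrossedProductAlg G C α CG) {g g' : G} (hg : g = g') {X Y : C.Obj}
    {f : C.Hom X (α.actObj g⁻¹ Y)} {f' : C.Hom X (α.actObj g'⁻¹ Y)} (hf : HEq f f') :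
    h.ins g f = h.ins g' f' := by
  subst hg; cases hf; rfl

/-- The inclusion `f ↦ (f, 1)` of `C` into the crossed product. -/
def unitFunctor (h : IsCrossedProductAlg G C α CG) : StarFunctor C CG where
  obj := h.obj
  map {_ Y} f := h.ins 1 (C.castHom rfl (α.one_inv_obj Y).symm f)
  map_add X Y f f' := by rw [castHom_add_eq, h.ins_add]
  map_smul X Y c f := by rw [castHom_smul_eq, h.ins_smul]
  map_comp X Y Z g f := by
    rw [h.ins_comp]
    refine ins_eq_of_heq h (mul_one 1).symm ?_
    refine (castHom_heq_self C _ _ _).trans (HEq.trans ?_ (castHom_heq_self C _ _ _).symm)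
    refine comp_heq_of_heq C rfl (α.one_inv_obj Y).symm ?_ ?_ (castHom_heq_self C _ _ _).symm
    · rw [α.one_inv_obj, α.one_inv_obj]
    · exact ((actMap_one_heq α inv_one _).trans (castHom_heq_self C _ _ _)).symm
  map_star X Y f := by
    rw [h.ins_star]
    refine ins_eq_of_heq h inv_one.symm ?_
    refine (castHom_heq_self C _ _ _).trans (HEq.trans ?_ (castHom_heq_self C _ _ _).symm)
    refine HEq.trans ?_ (actMap_one_heq α rfl _).symm
    exact star_heq_of_heq C rfl (α.one_inv_obj Y).symm (castHom_heq_self C _ _ _).symm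

theorem ins_star_comp_ins (h : IsCrossedProductAlg G C α CG) (g : G) {X Y : C.Obj}
    (f : C.Hom X (α.actObj g⁻¹ Y)) :
    CG.comp (CG.star (h.ins g f)) (h.ins g f) = (unitFunctor h).map (C.comp (C.star f) f) := by
  rw [h.ins_star, h.ins_comp]
  refine ins_eq_of_heq h (inv_mul_cancel g) ?_
  refine (castHom_heq_self C _ _ _).trans (HEq.trans ?_ (castHom_heq_self C _ _ _).symm)
  refine comp_heq_of_heq C rfl rfl ?_ ?_ HEq.rfl
  · rw [α.inv_inv_obj, α.mul_obj, inv_mul_cancel, α.one_obj]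
  · refine (actMap_heq_of_heq α rfl (α.cancel_obj g Y).symm (α.inv_inv_obj g X)
      (castHom_heq_self C _ _ _)).trans ?_
    exact (actMap_mul_heq α g⁻¹ g _).trans (actMap_one_heq α (inv_mul_cancel g) _)

end

theorem repNorm_le_maxNorm (C : StarCatNu) {X Y : C.Obj} (f : C.Hom X Y)
    (B : Type) [i : NonUnitalCStarAlgebra B] (ρ : StarFunctor C (StarCatNu.ofAlgebra B)) :
    C.repNorm f B ρ ≤ C.maxNorm f :=
  le_sSup ⟨B, i, ρ, rfl⟩

theorem repNorm_star_comp_self (C : StarCatNu) {X Y : C.Obj} (f : C.Hom X Y)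
    (B : Type) [i : NonUnitalCStarAlgebra B] (ρ : StarFunctor C (StarCatNu.ofAlgebra B)) :
    C.repNorm (C.comp (C.star f) f) B ρ = C.repNorm f B ρ * C.repNorm f B ρ := by
  have key : ∀ b c : B, c = star b * b → (‖c‖₊ : ℝ≥0∞) = (‖b‖₊ : ℝ≥0∞) * (‖b‖₊ : ℝ≥0∞) := by
    intro b c hc
    rw [hc, CStarRing.nnnorm_star_mul_self, ENNReal.coe_mul]
  refine key _ _ ?_
  have h1 := ρ.map_comp _ _ _ (C.star f) f
  rw [ρ.map_star] at h1
  exact h1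

theorem maxNorm_star_comp_self_le (C : StarCatNu) {X Y : C.Obj} (f : C.Hom X Y) :
    C.maxNorm (C.comp (C.star f) f) ≤ C.maxNorm f * C.maxNorm f := by
  refine sSup_le ?_
  rintro r ⟨B, i, ρ, rfl⟩
  rw [repNorm_star_comp_self]
  exact mul_le_mul' (repNorm_le_maxNorm C f B ρ) (repNorm_le_maxNorm C f B ρ)

theorem maxNorm_zero_eq (C : StarCatNu) {X Y : C.Obj} : C.maxNorm (0 : C.Hom X Y) = 0 := by
  refine le_antisymm (sSup_le ?_) bot_le
  rintro r ⟨B, i, ρ, rfl⟩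
  have key : ∀ b : B, b = 0 → (‖b‖₊ : ℝ≥0∞) ≤ 0 := by
    rintro b rfl; simp
  exact key _ (ρ.map_zero X Y)

theorem maxNorm_add_le (C : StarCatNu) {X Y : C.Obj} (f f' : C.Hom X Y) :
    C.maxNorm (f + f') ≤ C.maxNorm f + C.maxNorm f' := by
  refine sSup_le ?_
  rintro r ⟨B, i, ρ, rfl⟩
  have key : ∀ a b c : B, c = a + b → (‖c‖₊ : ℝ≥0∞) ≤ (‖a‖₊ : ℝ≥0∞) + (‖b‖₊ : ℝ≥0∞) := by
    rintro a b c rfl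
    exact_mod_cast nnnorm_add_le a b
  exact (key _ _ _ (ρ.map_add X Y f f')).trans
    (add_le_add (repNorm_le_maxNorm C f B ρ) (repNorm_le_maxNorm C f' B ρ))

theorem maxNorm_ins_le {G : Type} [Group G] {C : StarCatNu} {α : GAction G C} {CG : StarCatNu}
    (h : IsCrossedProductAlg G C α CG) (g : G) (X Y : C.Obj)
    (f : C.Hom X (α.actObj g⁻¹ Y)) : CG.maxNorm (h.ins g f) ≤ C.maxNorm f := by
  refine sSup_le ?_
  rintro r ⟨B, i, ρ, rfl⟩
  have h1 := repNorm_star_comp_self CG (h.ins g f) B ρ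
  rw [ins_star_comp_ins] at h1
  have h2 : CG.repNorm (h.ins g f) B ρ * CG.repNorm (h.ins g f) B ρ
      ≤ C.maxNorm f * C.maxNorm f := by
    rw [← h1]
    exact (repNorm_le_maxNorm C (C.comp (C.star f) f) B ((unitFunctor h).comp ρ)).trans
      (maxNorm_star_comp_self_le C f)
  by_contra hlt
  rw [not_le] at hlt
  exact absurd (ENNReal.mul_lt_mul hlt hlt) (not_lt.mpr h2)

/-- Let `G` be a group and `C` a possibly non-unital small C*-category
with `G`-action.  Then the algebraic crossed product `C ⋊^alg G` is a pre-C*-category;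
more precisely, for every morphism `f` of `C` and every `g ∈ G` one has
`‖(f, g)‖_max ≤ ‖f‖_C` (the norm of `f` in the C*-category `C` being its maximal norm). -/
theorem crossedProductAlg_isPreCStar
    (G : Type) [Group G] (C : StarCatNu) (hC : IsCStar C) (α : GAction G C)
    (CG : StarCatNu) (h : IsCrossedProductAlg G C α CG) :
    IsPreCStar CG ∧
      ∀ (g : G) (X Y : C.Obj) (f : C.Hom X (α.actObj g⁻¹ Y)),
        CG.maxNorm (h.ins g f) ≤ C.maxNorm f := by
  refine ⟨?_, fun g X Y f => maxNorm_ins_le h g X Y f⟩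
  intro X' Y' u
  obtain ⟨X, rfl⟩ := h.obj_bij.surjective X'
  obtain ⟨Y, rfl⟩ := h.obj_bij.surjective Y'
  obtain ⟨s, φ, rfl⟩ := h.span X Y u
  classical
  induction s using Finset.induction_on with
  | empty => rw [Finset.sum_empty, maxNorm_zero_eq]; exact ENNReal.zero_lt_top
  | insert a s ha ih =>
    rw [Finset.sum_insert ha]
    exact (maxNorm_add_le CG _ _).trans_lt
      (ENNReal.add_lt_top.mpr ⟨(maxNorm_ins_le h a X Y (φ a)).trans_lt (hC.1 _ _ _), ih⟩)
end
end

section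
/- Let G be a group, C a possibly non-unital small C*-category with G-action, and D a possibly non-unital small C*-category. (1) Every covariant representation (ρ,π) of C on D induces a morphism σ : C⋊G → D (acting like ρ on objects and sending (f,g) with f : C → C' to π(g)_{C'}∘ρ(f)), and every unitary natural transformation (ρ,π) → (ρ',π') of covariant representations induces a unitary isomorphism σ → σ' of the induced morphisms. (2) If C is unital, this construction is an isomorphism between the groupoid of covariant representations (ρ,π) with unital ρ and unitary natural transformations, and the groupoid of unital morphisms C⋊G → D and unitary isomorphisms. -/
noncomputable section

open scoped ENNReal

/-- A covariant representation `(ρ, π)` of the C*-category `C` with `G`-action `α` on the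
C*-category `D`: a morphism `ρ : C → D` together with a family `π` of unitary natural
transformations `π(g) : ρ → g* ρ` satisfying `g*π(h) ∘ π(g) = π(hg)`. -/
structure CovariantRep (G : Type) [Group G] (C : StarCatNu) (α : GAction G C)
    (D : StarCatNu) where
  ρ : StarFunctor C D
  π : ∀ (g : G) (X : C.Obj), D.Hom (ρ.obj X) (ρ.obj (α.actObj g X))
  π_unitary : ∀ (g : G) (X : C.Obj), IsUnitary D (π g X)
  π_natural : ∀ (g : G) (X Y : C.Obj) (f : C.Hom X Y),
    D.comp (π g Y) (ρ.map f) = D.comp (ρ.map (α.actMap g f)) (π g X)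
  π_mul : ∀ (g h : G) (X : C.Obj),
    D.castHom rfl (congrArg ρ.obj (α.mul_obj h g X))
      (D.comp (π h (α.actObj g X)) (π g X)) = π (h * g) X

/-- A unitary natural transformation between covariant representations. -/
structure CovRepTrans {G : Type} [Group G] {C : StarCatNu} {α : GAction G C}
    {D : StarCatNu} (R R' : CovariantRep G C α D) where
  app : ∀ X : C.Obj, D.Hom (R.ρ.obj X) (R'.ρ.obj X)
  natural : ∀ (X Y : C.Obj) (f : C.Hom X Y),
    D.comp (app Y) (R.ρ.map f) = D.comp (R'.ρ.map f) (app X)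
  unitary : ∀ X : C.Obj, IsUnitary D (app X)
  compat : ∀ (g : G) (X : C.Obj),
    D.comp (R'.π g X) (app X) = D.comp (app (α.actObj g X)) (R.π g X)

/-- The morphism `σ : C ⋊ G → D` induced by a covariant representation `(ρ, π)`:
it acts like `ρ` on objects and sends a generator `(f, g)` with `f : X → g⁻¹Y` to
`π(g)_{g⁻¹Y} ∘ ρ(f)`. -/
structure Induces {G : Type} [Group G] {C : StarCatNu} {α : GAction G C}
    {CG CGc D : StarCatNu} (h : IsCrossedProductAlg G C α CG)
    (κ : StarFunctor CG CGc) (R : CovariantRep G C α D)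
    (σ : StarFunctor CGc D) : Prop where
  obj_eq : ∀ X : C.Obj, σ.obj (κ.obj (h.obj X)) = R.ρ.obj X
  map_eq : ∀ (g : G) (X Y : C.Obj) (f : C.Hom X (α.actObj g⁻¹ Y)),
    D.castHom (obj_eq X) (obj_eq Y) (σ.map (κ.map (h.ins g f))) =
      D.castHom rfl (congrArg R.ρ.obj (α.cancel_obj g Y))
        (D.comp (R.π g (α.actObj g⁻¹ Y)) (R.ρ.map f))

/-! ### Casts -/

namespace CovAux

section casts

variable {C D : StarCatNu}

theorem cast_comp (C : StarCatNu) {X X' Y Y' Z Z' : C.Obj} (hX : X = X') (hY : Y = Y') (hZ : Z = Z')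
    (g : C.Hom Y Z) (f : C.Hom X Y) :
    C.castHom hX hZ (C.comp g f) = C.comp (C.castHom hY hZ g) (C.castHom hX hY f) := by
  subst hX hY hZ; rfl

theorem cast_add {X X' Y Y' : C.Obj} (hX : X = X') (hY : Y = Y') (f g : C.Hom X Y) :
    C.castHom hX hY (f + g) = C.castHom hX hY f + C.castHom hX hY g := by
  subst hX hY; rfl

theorem cast_zero {X X' Y Y' : C.Obj} (hX : X = X') (hY : Y = Y') :
    C.castHom hX hY 0 = 0 := by
  subst hX hY; rfl

theorem cast_smul {X X' Y Y' : C.Obj} (hX : X = X') (hY : Y = Y') (c : ℂ) (f : C.Hom X Y) :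
    C.castHom hX hY (c • f) = c • C.castHom hX hY f := by
  subst hX hY; rfl

theorem cast_star {X X' Y Y' : C.Obj} (hX : X = X') (hY : Y = Y') (f : C.Hom X Y) :
    C.castHom hY hX (C.star f) = C.star (C.castHom hX hY f) := by
  subst hX hY; rfl

theorem cast_cast {X X' X'' Y Y' Y'' : C.Obj} (hX : X = X') (hY : Y = Y')
    (hX' : X' = X'') (hY' : Y' = Y'') (f : C.Hom X Y) :
    C.castHom hX' hY' (C.castHom hX hY f) = C.castHom (hX.trans hX') (hY.trans hY') f := by
  subst hX hY hX' hY'; rfl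

theorem cast_eq_iff {X X' Y Y' : C.Obj} (hX : X = X') (hY : Y = Y') (f : C.Hom X Y)
    (g : C.Hom X' Y') :
    C.castHom hX hY f = g ↔ f = C.castHom hX.symm hY.symm g := by
  subst hX hY; rfl

theorem cast_inj {X X' Y Y' : C.Obj} (hX : X = X') (hY : Y = Y') (f g : C.Hom X Y)
    (h : C.castHom hX hY f = C.castHom hX hY g) : f = g := by
  subst hX hY; exact h

theorem map_cast (F : StarFunctor C D) {X X' Y Y' : C.Obj} (hX : X = X') (hY : Y = Y')
    (f : C.Hom X Y) :
    F.map (C.castHom hX hY f) =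
      D.castHom (congrArg F.obj hX) (congrArg F.obj hY) (F.map f) := by
  subst hX hY; rfl

theorem isIdentityAt_cast {X X' : C.Obj} (hX : X = X') {f : C.Hom X X} (hf : IsIdentityAt C f) :
    IsIdentityAt C (C.castHom hX hX f) := by
  subst hX; exact hf

theorem isUnitary_cast {X X' Y Y' : C.Obj} (hX : X = X') (hY : Y = Y') {f : C.Hom X Y}
    (hf : IsUnitary C f) : IsUnitary C (C.castHom hX hY f) := by
  subst hX hY; exact hf

theorem maxNorm_cast {X X' Y Y' : C.Obj} (hX : X = X') (hY : Y = Y') (f : C.Hom X Y) :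
    C.maxNorm (C.castHom hX hY f) = C.maxNorm f := by
  subst hX hY; rfl

theorem functor_ext {F F' : StarFunctor C D} (ho : ∀ X, F.obj X = F'.obj X)
    (hm : ∀ X Y (f : C.Hom X Y), D.castHom (ho X) (ho Y) (F.map f) = F'.map f) : F = F' := by
  obtain ⟨o, m, _, _, _, _⟩ := F
  obtain ⟨o', m', _, _, _, _⟩ := F'
  obtain rfl : o = o' := funext ho
  have : @m = @m' := by
    funext X Y f
    exact hm X Y f
  subst this
  rfl

theorem identity_unique {X : C.Obj} {e e' : C.Hom X X} (he : IsIdentityAt C e)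
    (he' : IsIdentityAt C e') : e = e' := by
  rw [← he.1 _ e', he'.2]

theorem identity_star {X : C.Obj} {e : C.Hom X X} (he : IsIdentityAt C e) :
    C.star e = e := by
  have h1 : IsIdentityAt C (C.star e) := by
    refine ⟨fun Y f => ?_, fun Y f => ?_⟩
    · rw [← C.star_star (C.comp f (C.star e)), C.star_comp, C.star_star, he.2, C.star_star]
    · rw [← C.star_star (C.comp (C.star e) f), C.star_comp, C.star_star, he.1, C.star_star]
  exact identity_unique h1 he

theorem comp_neg {X Y Z : C.Obj} (g : C.Hom Y Z) (f : C.Hom X Y) :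
    C.comp g (-f) = -C.comp g f :=
  (AddMonoidHom.mk' (fun f : C.Hom X Y => C.comp g f) (C.comp_add g)).map_neg f

theorem neg_comp {X Y Z : C.Obj} (g : C.Hom Y Z) (f : C.Hom X Y) :
    C.comp (-g) f = -C.comp g f :=
  (AddMonoidHom.mk' (fun g : C.Hom Y Z => C.comp g f) (fun a b => C.add_comp a b f)).map_neg g

theorem comp_sub {X Y Z : C.Obj} (g : C.Hom Y Z) (f f' : C.Hom X Y) :
    C.comp g (f - f') = C.comp g f - C.comp g f' := by
  rw [sub_eq_add_neg, C.comp_add, comp_neg, ← sub_eq_add_neg]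

theorem sub_comp {X Y Z : C.Obj} (g g' : C.Hom Y Z) (f : C.Hom X Y) :
    C.comp (g - g') f = C.comp g f - C.comp g' f := by
  rw [sub_eq_add_neg, C.add_comp, neg_comp, ← sub_eq_add_neg]

theorem star_sub {X Y : C.Obj} (f f' : C.Hom X Y) :
    C.star (f - f') = C.star f - C.star f' :=
  (AddMonoidHom.mk' (fun f : C.Hom X Y => C.star f) C.star_add).map_sub f f'

theorem fmap_sub (F : StarFunctor C D) {X Y : C.Obj} (f f' : C.Hom X Y) :
    F.map (f - f') = F.map f - F.map f' :=
  (AddMonoidHom.mk' (fun f : C.Hom X Y => F.map f) (F.map_add X Y)).map_sub f f'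

end casts

/-! ### The maximal norm -/

section norm

variable {C D : StarCatNu}

theorem maxNorm_le {X Y : C.Obj} (f : C.Hom X Y) (c : ℝ≥0∞)
    (H : ∀ (B : Type) (i : NonUnitalCStarAlgebra B)
      (ρ : StarFunctor C (StarCatNu.ofAlgebra B)), C.repNorm f B ρ ≤ c) : C.maxNorm f ≤ c := by
  refine sSup_le ?_
  rintro _ ⟨B, i, ρ, rfl⟩
  exact H B i ρ

theorem le_maxNorm {X Y : C.Obj} (f : C.Hom X Y) (B : Type) [i : NonUnitalCStarAlgebra B]
    (ρ : StarFunctor C (StarCatNu.ofAlgebra B)) : C.repNorm f B ρ ≤ C.maxNorm f :=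
  le_sSup ⟨B, i, ρ, rfl⟩

theorem maxNorm_zero {X Y : C.Obj} : C.maxNorm (0 : C.Hom X Y) = 0 := by
  refine le_antisymm (maxNorm_le _ _ fun B i ρ => ?_) bot_le
  unfold StarCatNu.repNorm
  rw [ρ.map_zero]
  have : ‖(0 : B)‖₊ = 0 := nnnorm_zero
  exact (ENNReal.coe_eq_zero.2 this).le

theorem maxNorm_add {X Y : C.Obj} (f g : C.Hom X Y) :
    C.maxNorm (f + g) ≤ C.maxNorm f + C.maxNorm g := by
  refine maxNorm_le _ _ fun B i ρ => ?_
  refine le_trans ?_ (add_le_add (le_maxNorm f B ρ) (le_maxNorm g B ρ))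
  unfold StarCatNu.repNorm
  rw [ρ.map_add, ← ENNReal.coe_add]
  exact ENNReal.coe_le_coe.2 (nnnorm_add_le (E := B) (ρ.map f) (ρ.map g))

theorem maxNorm_smul {X Y : C.Obj} (c : ℂ) (f : C.Hom X Y) :
    C.maxNorm (c • f) ≤ (‖c‖₊ : ℝ≥0∞) * C.maxNorm f := by
  refine maxNorm_le _ _ fun B i ρ => ?_
  refine le_trans ?_ (mul_le_mul_right (le_maxNorm f B ρ) _)
  unfold StarCatNu.repNorm
  rw [ρ.map_smul, ← ENNReal.coe_mul]
  exact ENNReal.coe_le_coe.2 (nnnorm_smul_le (β := B) c (ρ.map f))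

theorem maxNorm_comp {X Y Z : C.Obj} (g : C.Hom Y Z) (f : C.Hom X Y) :
    C.maxNorm (C.comp g f) ≤ C.maxNorm g * C.maxNorm f := by
  refine maxNorm_le _ _ fun B i ρ => ?_
  refine le_trans ?_ (mul_le_mul' (le_maxNorm g B ρ) (le_maxNorm f B ρ))
  unfold StarCatNu.repNorm
  rw [ρ.map_comp, ← ENNReal.coe_mul]
  exact ENNReal.coe_le_coe.2 (nnnorm_mul_le (α := B) (ρ.map g) (ρ.map f))

theorem maxNorm_star {X Y : C.Obj} (f : C.Hom X Y) :
    C.maxNorm (C.star f) ≤ C.maxNorm f := by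
  refine maxNorm_le _ _ fun B i ρ => ?_
  refine le_trans ?_ (le_maxNorm f B ρ)
  unfold StarCatNu.repNorm
  rw [ρ.map_star]
  exact ENNReal.coe_le_coe.2 (nnnorm_star (E := B) (ρ.map f)).le

theorem maxNorm_map (F : StarFunctor C D) {X Y : C.Obj} (f : C.Hom X Y) :
    D.maxNorm (F.map f) ≤ C.maxNorm f :=
  maxNorm_le _ _ fun B _ ρ => le_maxNorm f B (F.comp ρ)

theorem maxNorm_neg {X Y : C.Obj} (f : C.Hom X Y) : C.maxNorm (-f) ≤ C.maxNorm f := by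
  have := maxNorm_smul (C := C) (-1) f
  simpa using this

theorem maxNorm_sub_comm {X Y : C.Obj} (f g : C.Hom X Y) :
    C.maxNorm (f - g) = C.maxNorm (g - f) := by
  apply le_antisymm
  · have := maxNorm_neg (g - f); rwa [neg_sub] at this
  · have := maxNorm_neg (f - g); rwa [neg_sub] at this

theorem maxNorm_sub_le {X Y : C.Obj} (f g k : C.Hom X Y) :
    C.maxNorm (f - k) ≤ C.maxNorm (f - g) + C.maxNorm (g - k) := by
  have := maxNorm_add (f - g) (g - k)
  rwa [sub_add_sub_cancel] at this

open Filter Topology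

/-- Convergence with respect to the maximal norm. -/
def Conv (C : StarCatNu) {X Y : C.Obj} (u : ℕ → C.Hom X Y) (f : C.Hom X Y) : Prop :=
  Tendsto (fun n => C.maxNorm (u n - f)) atTop (𝓝 0)

theorem conv_of_le {X Y : C.Obj} {u : ℕ → C.Hom X Y} {f : C.Hom X Y} {b : ℕ → ℝ≥0∞}
    (hb : Tendsto b atTop (𝓝 0)) (h : ∀ n, C.maxNorm (u n - f) ≤ b n) : Conv C u f :=
  tendsto_of_tendsto_of_tendsto_of_le_of_le tendsto_const_nhds hb (fun _ => bot_le) h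

theorem conv_const {X Y : C.Obj} (f : C.Hom X Y) : Conv C (fun _ => f) f := by
  refine conv_of_le tendsto_const_nhds fun n => ?_
  rw [sub_self, maxNorm_zero]

theorem Conv.add {X Y : C.Obj} {u v : ℕ → C.Hom X Y} {f g : C.Hom X Y}
    (hu : Conv C u f) (hv : Conv C v g) : Conv C (fun n => u n + v n) (f + g) := by
  have := Tendsto.add hu hv
  rw [add_zero] at this
  refine conv_of_le this fun n => ?_
  rw [add_sub_add_comm]
  exact maxNorm_add _ _

theorem Conv.smul {X Y : C.Obj} {u : ℕ → C.Hom X Y} {f : C.Hom X Y} (c : ℂ)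
    (hu : Conv C u f) : Conv C (fun n => c • u n) (c • f) := by
  have := ENNReal.Tendsto.const_mul (a := (‖c‖₊ : ℝ≥0∞)) hu (Or.inr ENNReal.coe_ne_top)
  rw [mul_zero] at this
  refine conv_of_le this fun n => ?_
  rw [← smul_sub]
  exact maxNorm_smul _ _

theorem Conv.star {X Y : C.Obj} {u : ℕ → C.Hom X Y} {f : C.Hom X Y}
    (hu : Conv C u f) : Conv C (fun n => C.star (u n)) (C.star f) := by
  refine conv_of_le hu fun n => ?_
  rw [← star_sub]
  exact maxNorm_star _

theorem Conv.map (F : StarFunctor C D) {X Y : C.Obj} {u : ℕ → C.Hom X Y} {f : C.Hom X Y}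
    (hu : Conv C u f) : Conv D (fun n => F.map (u n)) (F.map f) := by
  refine conv_of_le hu fun n => ?_
  rw [← fmap_sub]
  exact maxNorm_map _ _

theorem Conv.cast {X Y X' Y' : C.Obj} (hX : X = X') (hY : Y = Y')
    {u : ℕ → C.Hom X Y} {f : C.Hom X Y}
    (hu : Conv C u f) : Conv C (fun n => C.castHom hX hY (u n)) (C.castHom hX hY f) := by
  subst hX hY; exact hu

theorem Conv.comp (hC : IsPreCStar C) {X Y Z : C.Obj} {v : ℕ → C.Hom Y Z} {u : ℕ → C.Hom X Y}
    {g : C.Hom Y Z} {f : C.Hom X Y}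
    (hv : Conv C v g) (hu : Conv C u f) : Conv C (fun n => C.comp (v n) (u n)) (C.comp g f) := by
  have h1 := ENNReal.Tendsto.mul_const (b := C.maxNorm f) hv (Or.inr (hC _ _ f).ne)
  have h2 := ENNReal.Tendsto.const_mul (a := C.maxNorm g) hu (Or.inr (hC _ _ g).ne)
  have h3 := ENNReal.Tendsto.mul hv (Or.inr ENNReal.zero_ne_top) hu (Or.inr ENNReal.zero_ne_top)
  have := (h1.add h2).add h3
  simp only [zero_mul, mul_zero, add_zero] at this
  refine conv_of_le this fun n => ?_
  have e : C.comp (v n) (u n) - C.comp g f =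
      C.comp (v n - g) f + C.comp g (u n - f) + C.comp (v n - g) (u n - f) := by
    simp only [comp_sub, sub_comp]; abel
  rw [e]
  refine (maxNorm_add _ _).trans (add_le_add ((maxNorm_add _ _).trans (add_le_add ?_ ?_)) ?_) <;>
  exact maxNorm_comp _ _

theorem Conv.unique (hC : IsCStar C) {X Y : C.Obj} {u : ℕ → C.Hom X Y} {f g : C.Hom X Y}
    (hu : Conv C u f) (hv : Conv C u g) : f = g := by
  have := Tendsto.add hu hv
  rw [add_zero] at this
  have h0 : C.maxNorm (f - g) ≤ 0 := by
    refine ge_of_tendsto' this fun n => ?_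
    rw [maxNorm_sub_comm (u n) f]
    exact maxNorm_sub_le _ _ _
  exact sub_eq_zero.1 (hC.2.1 _ _ _ (le_antisymm h0 bot_le))

end norm

/-! ### Transport along bijections of objects -/

section lift

variable {A B : StarCatNu}

/-- Full pullback along a map of objects. -/
def pull (A : StarCatNu) {O : Type} (k : O → A.Obj) : StarCatNu where
  Obj := O
  Hom X Y := A.Hom (k X) (k Y)
  comp g f := A.comp g f
  star f := A.star f
  comp_assoc := A.comp_assoc
  add_comp := A.add_comp
  comp_add := A.comp_add
  smul_comp := A.smul_comp
  comp_smul := A.comp_smul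
  star_star := A.star_star
  star_comp := A.star_comp
  star_add := A.star_add
  star_smul := A.star_smul

theorem exists_lift {O : Type} (k : O → A.Obj) (hk : Function.Bijective k)
    (F : StarFunctor (pull A k) B) :
    ∃ (F' : StarFunctor A B) (ho : ∀ X, F'.obj (k X) = F.obj X),
      ∀ (X Y : O) (f : A.Hom (k X) (k Y)),
        B.castHom (ho X) (ho Y) (F'.map f) = F.map (X := X) (Y := Y) f := by
  let e := Equiv.ofBijective k hk
  have r : ∀ Z, Z = k (e.symm Z) := fun Z => (e.apply_symm_apply Z).symm
  have l : ∀ X, e.symm (k X) = X := fun X => e.symm_apply_apply X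
  refine ⟨{ obj := fun Z => F.obj (e.symm Z)
            map := fun {Z W} f => F.map (X := e.symm Z) (Y := e.symm W) (A.castHom (r Z) (r W) f)
            map_add := fun Z W f f' => ?_
            map_smul := fun Z W c f => ?_
            map_comp := fun Z W V g f => ?_
            map_star := fun Z W f => ?_ }, fun X => congrArg F.obj (l X), ?_⟩
  · rw [cast_add]; exact F.map_add _ _ _ _
  · rw [cast_smul]; exact F.map_smul _ _ _ _
  · rw [cast_comp A (r Z) (r W) (r V)]; exact F.map_comp _ _ _ _ _
  · rw [cast_star]; exact F.map_star _ _ _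
  · intro X Y f
    have key : ∀ (X' Y' : O) (hX : X' = X) (hY : Y' = Y) (p : k X = k X') (q : k Y = k Y'),
        B.castHom (congrArg F.obj hX) (congrArg F.obj hY)
          (F.map (X := X') (Y := Y') (A.castHom p q f)) = F.map (X := X) (Y := Y) f := by
      rintro _ _ rfl rfl p q
      rfl
    exact key _ _ (l X) (l Y) _ _

open Filter Topology

theorem dense_seq {A Ac : StarCatNu} {κ : StarFunctor A Ac} (hκ : IsCompletion A Ac κ)
    {X Y : A.Obj} (u : Ac.Hom (κ.obj X) (κ.obj Y)) :
    ∃ f : ℕ → A.Hom X Y, Conv Ac (fun n => κ.map (f n)) u := by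
  have : ∀ n : ℕ, ∃ f : A.Hom X Y, Ac.maxNorm (u - κ.map f) < ((n : ℝ≥0∞) + 1)⁻¹ := fun n =>
    hκ.dense X Y u _ (by
      rw [ENNReal.inv_pos]; exact ENNReal.add_ne_top.2 ⟨ENNReal.natCast_ne_top n, ENNReal.one_ne_top⟩)
  choose f hf using this
  refine ⟨f, conv_of_le (b := fun n : ℕ => ((n : ℝ≥0∞))⁻¹) ENNReal.tendsto_inv_nat_nhds_zero
    fun n => ?_⟩
  rw [maxNorm_sub_comm]
  exact (hf n).le.trans (ENNReal.inv_le_inv.2 le_self_add)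

theorem exists_extension {A Ac D : StarCatNu} {κ : StarFunctor A Ac} (hκ : IsCompletion A Ac κ)
    (hD : IsCStar D) (F : StarFunctor A D) :
    ∃ (F' : StarFunctor Ac D) (ho : ∀ X, F'.obj (κ.obj X) = F.obj X),
      ∀ (X Y : A.Obj) (f : A.Hom X Y),
        D.castHom (ho X) (ho Y) (F'.map (κ.map f)) = F.map f := by
  have hA := hκ.pre
  let L : ∀ X Y : A.Obj, Ac.Hom (κ.obj X) (κ.obj Y) → D.Hom (F.obj X) (F.obj Y) → Prop :=
    fun X Y u y => ∃ f : ℕ → A.Hom X Y, Conv Ac (fun n => κ.map (f n)) u ∧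
      Conv D (fun n => F.map (f n)) y
  have hex : ∀ X Y u, ∃ y, L X Y u y := by
    intro X Y u
    obtain ⟨f, hf⟩ := dense_seq hκ u
    have hb : ∀ m n, D.maxNorm (F.map (f m) - F.map (f n)) ≤
        Ac.maxNorm (κ.map (f m) - u) + Ac.maxNorm (κ.map (f n) - u) := by
      intro m n
      rw [← fmap_sub]
      refine (maxNorm_map F _).trans ?_
      rw [← hκ.isometric, fmap_sub, maxNorm_sub_comm (κ.map (f n)) u]
      exact maxNorm_sub_le _ _ _
    obtain ⟨y, hy⟩ := hD.2.2 _ _ (fun n => F.map (f n)) (by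
      intro ε hε
      have h2 : 0 < ε / 2 := ENNReal.half_pos hε.ne'
      obtain ⟨N, hN⟩ := eventually_atTop.1 ((tendsto_order.1 hf).2 _ h2)
      refine ⟨N, fun m hm n hn => (hb m n).trans_lt ?_⟩
      rw [← ENNReal.add_halves ε]
      exact ENNReal.add_lt_add (hN m hm) (hN n hn))
    refine ⟨y, f, hf, ?_⟩
    refine tendsto_order.2 ⟨fun a ha => absurd ha (not_lt_bot), fun a ha => ?_⟩
    exact eventually_atTop.2 (hy a ha)
  have huniq : ∀ X Y u y y', L X Y u y → L X Y u y' → y = y' := by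
    rintro X Y u y y' ⟨f, hf, hy⟩ ⟨f', hf', hy'⟩
    refine Conv.unique hD (u := fun n => F.map (f n)) hy ?_
    have := (Tendsto.add hf hf').add hy'
    simp only [add_zero] at this
    refine conv_of_le this fun n => ?_
    refine (maxNorm_sub_le _ (F.map (f' n)) _).trans (add_le_add ?_ le_rfl)
    rw [← fmap_sub]
    refine (maxNorm_map F _).trans ?_
    rw [← hκ.isometric, fmap_sub, maxNorm_sub_comm (κ.map (f' n)) u]
    exact maxNorm_sub_le _ _ _
  choose m hm using hex
  have hadd : ∀ X Y u v, m X Y (u + v) = m X Y u + m X Y v := by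
    intro X Y u v
    obtain ⟨f, hf, hy⟩ := hm X Y u
    obtain ⟨f', hf', hy'⟩ := hm X Y v
    refine huniq _ _ _ _ _ (hm _ _ _) ⟨fun n => f n + f' n, ?_, ?_⟩
    · simp only [κ.map_add]; exact hf.add hf'
    · simp only [F.map_add]; exact hy.add hy'
  have hsmul : ∀ X Y (c : ℂ) u, m X Y (c • u) = c • m X Y u := by
    intro X Y c u
    obtain ⟨f, hf, hy⟩ := hm X Y u
    refine huniq _ _ _ _ _ (hm _ _ _) ⟨fun n => c • f n, ?_, ?_⟩
    · simp only [κ.map_smul]; exact hf.smul c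
    · simp only [F.map_smul]; exact hy.smul c
  have hcomp : ∀ X Y Z v u, m X Z (Ac.comp v u) = D.comp (m Y Z v) (m X Y u) := by
    intro X Y Z v u
    obtain ⟨f, hf, hy⟩ := hm X Y u
    obtain ⟨f', hf', hy'⟩ := hm Y Z v
    refine huniq _ _ _ _ _ (hm _ _ _) ⟨fun n => A.comp (f' n) (f n), ?_, ?_⟩
    · simp only [κ.map_comp]; exact hf'.comp hκ.cstar.1 hf
    · simp only [F.map_comp]; exact hy'.comp hD.1 hy
  have hstar : ∀ X Y u, m Y X (Ac.star u) = D.star (m X Y u) := by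
    intro X Y u
    obtain ⟨f, hf, hy⟩ := hm X Y u
    refine huniq _ _ _ _ _ (hm _ _ _) ⟨fun n => A.star (f n), ?_, ?_⟩
    · simp only [κ.map_star]; exact hf.star
    · simp only [F.map_star]; exact hy.star
  let E : StarFunctor (pull Ac κ.obj) D :=
    { obj := F.obj
      map := fun {X Y} u => m X Y u
      map_add := hadd
      map_smul := hsmul
      map_comp := hcomp
      map_star := hstar }
  obtain ⟨F', ho, h'⟩ := exists_lift κ.obj hκ.obj_bij E
  refine ⟨F', ho, fun X Y f => ?_⟩
  refine (h' X Y (κ.map f)).trans ?_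
  exact huniq _ _ _ _ _ (hm _ _ _) ⟨fun _ => f, conv_const _, conv_const _⟩

end lift

/-! ### Cast-free versions of the structure maps -/

section action

variable {G : Type} [Group G] {C : StarCatNu} (α : GAction G C)

/-- The action on morphisms, with prescribed source and target. -/
def act (g : G) {X Y X' Y' : C.Obj} (hX : α.actObj g X = X') (hY : α.actObj g Y = Y')
    (f : C.Hom X Y) : C.Hom X' Y' := C.castHom hX hY (α.actMap g f)

variable {α}

theorem inv_obj {g : G} {X X' : C.Obj} (e : α.actObj g X = X') : α.actObj g⁻¹ X' = X := by
  rw [← e, α.mul_obj, inv_mul_cancel, α.one_obj]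

theorem obj_inv {g : G} {X X' : C.Obj} (e : α.actObj g⁻¹ X' = X) : α.actObj g X = X' := by
  rw [← e, α.cancel_obj]

theorem mul_obj_eq {g h : G} {X Y Z : C.Obj} (e : α.actObj g X = Y) (e' : α.actObj h Y = Z) :
    α.actObj (h * g) X = Z := by
  rw [← e', ← e, α.mul_obj]

theorem act_one {g : G} (hg : g = 1) {X Y : C.Obj} (hX : α.actObj g X = X) (hY : α.actObj g Y = Y)
    (f : C.Hom X Y) : act α g hX hY f = f := by
  subst hg
  exact α.one_map X Y f

theorem act_mul {g h : G} {X Y X' Y' X'' Y'' : C.Obj} (hX : α.actObj h X = X')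
    (hY : α.actObj h Y = Y') (hX' : α.actObj g X' = X'') (hY' : α.actObj g Y' = Y'')
    (EX : α.actObj (g * h) X = X'') (EY : α.actObj (g * h) Y = Y'') (f : C.Hom X Y) :
    act α g hX' hY' (act α h hX hY f) = act α (g * h) EX EY f := by
  subst hX hY hX' hY'
  unfold act
  rw [← α.mul_map, cast_cast]
  rfl

theorem act_inv_cancel {g : G} {X Y X' Y' : C.Obj} (hX : α.actObj g X = X')
    (hY : α.actObj g Y = Y') (hX' : α.actObj g⁻¹ X' = X) (hY' : α.actObj g⁻¹ Y' = Y)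
    (f : C.Hom X Y) : act α g⁻¹ hX' hY' (act α g hX hY f) = f := by
  rw [act_mul hX hY hX' hY' (mul_obj_eq hX hX') (mul_obj_eq hY hY')]
  exact act_one (inv_mul_cancel g) _ _ _

theorem act_cancel_inv {g : G} {X Y X' Y' : C.Obj} (hX : α.actObj g X = X')
    (hY : α.actObj g Y = Y') (hX' : α.actObj g⁻¹ X' = X) (hY' : α.actObj g⁻¹ Y' = Y)
    (f : C.Hom X' Y') : act α g hX hY (act α g⁻¹ hX' hY' f) = f := by
  rw [act_mul hX' hY' hX hY (mul_obj_eq hX' hX) (mul_obj_eq hY' hY)]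
  exact act_one (mul_inv_cancel g) _ _ _

theorem act_comp {g : G} {X Y Z X' Y' Z' : C.Obj} (hX : α.actObj g X = X')
    (hY : α.actObj g Y = Y') (hZ : α.actObj g Z = Z') (u : C.Hom Y Z) (f : C.Hom X Y) :
    act α g hX hZ (C.comp u f) = C.comp (act α g hY hZ u) (act α g hX hY f) := by
  subst hX hY hZ
  exact α.map_comp g _ _ _ u f

theorem act_identity {g : G} {X X' : C.Obj} (hX : α.actObj g X = X') {e : C.Hom X X}
    (he : IsIdentityAt C e) : IsIdentityAt C (act α g hX hX e) := by
  refine ⟨fun Y f => ?_, fun Y f => ?_⟩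
  · have hY : α.actObj g (α.actObj g⁻¹ Y) = Y := α.cancel_obj g Y
    rw [← act_cancel_inv hX hY (inv_obj hX) (inv_obj hY) f, ← act_comp, he.1]
  · have hY : α.actObj g (α.actObj g⁻¹ Y) = Y := α.cancel_obj g Y
    rw [← act_cancel_inv hY hX (inv_obj hY) (inv_obj hX) f, ← act_comp, he.2]

end action

section crossed

variable {G : Type} [Group G] {C : StarCatNu} {α : GAction G C} {CG : StarCatNu}
  (h : IsCrossedProductAlg G C α CG)

/-- The generator `(f, g)` with prescribed target. -/
def ins (g : G) {X Y Y' : C.Obj} (e : α.actObj g⁻¹ Y = Y') (f : C.Hom X Y') :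
    CG.Hom (h.obj X) (h.obj Y) := h.ins g (C.castHom rfl e.symm f)

variable {h}

theorem ins_congr {g g' : G} (hg : g = g') {X Y Y' : C.Obj} (e : α.actObj g⁻¹ Y = Y')
    (e' : α.actObj g'⁻¹ Y = Y') (f : C.Hom X Y') : ins h g e f = ins h g' e' f := by
  subst hg; rfl

theorem ins_comp {g g' : G} {X Y Z Y' Z' Z'' : C.Obj}
    (e : α.actObj g⁻¹ Y = Y') (e' : α.actObj g'⁻¹ Z = Z') (e'' : α.actObj g⁻¹ Z' = Z'')
    (E : α.actObj (g' * g)⁻¹ Z = Z'') (f : C.Hom X Y') (f' : C.Hom Y Z') :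
    CG.comp (ins h g' e' f') (ins h g e f) =
      ins h (g' * g) E (C.comp (act α g⁻¹ e e'' f') f) := by
  subst e e' e''
  exact h.ins_comp _ _ _ _ _ _ _

theorem ins_star {g : G} {X X' Y Y' : C.Obj} (e : α.actObj g⁻¹ Y = Y')
    (e1 : α.actObj g Y' = Y) (e2 : α.actObj g X = X') (E : α.actObj g⁻¹⁻¹ X = X')
    (f : C.Hom X Y') :
    CG.star (ins h g e f) = ins h g⁻¹ E (act α g e1 e2 (C.star f)) := by
  subst e e2
  refine (h.ins_star _ _ _ _).trans ?_
  unfold ins act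
  rw [cast_cast]
  rfl

theorem ins_add {g : G} {X Y Y' : C.Obj} (e : α.actObj g⁻¹ Y = Y') (f f' : C.Hom X Y') :
    ins h g e (f + f') = ins h g e f + ins h g e f' := by
  subst e; exact h.ins_add _ _ _ _ _

theorem ins_smul {g : G} {X Y Y' : C.Obj} (e : α.actObj g⁻¹ Y = Y') (c : ℂ) (f : C.Hom X Y') :
    ins h g e (c • f) = c • ins h g e f := by
  subst e; exact h.ins_smul _ _ _ _ _

theorem ins_induction {X Y : C.Obj} (P : CG.Hom (h.obj X) (h.obj Y) → Prop) (h0 : P 0)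
    (hadd : ∀ u v, P u → P v → P (u + v))
    (hins : ∀ (g : G) (Y' : C.Obj) (e : α.actObj g⁻¹ Y = Y') (f : C.Hom X Y'), P (ins h g e f))
    (u : CG.Hom (h.obj X) (h.obj Y)) : P u := by
  obtain ⟨s, φ, rfl⟩ := h.span X Y u
  exact Finset.sum_induction _ P hadd h0 fun g _ => hins g _ rfl (φ g)

theorem dense_induction {CGc : StarCatNu} {κ : StarFunctor CG CGc} (hκ : IsCompletion CG CGc κ)
    {X Y : C.Obj} (P : CGc.Hom (κ.obj (h.obj X)) (κ.obj (h.obj Y)) → Prop) (h0 : P 0)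
    (hadd : ∀ u v, P u → P v → P (u + v))
    (hins : ∀ (g : G) (Y' : C.Obj) (e : α.actObj g⁻¹ Y = Y') (f : C.Hom X Y'),
      P (κ.map (ins h g e f)))
    (hconv : ∀ (u : ℕ → CGc.Hom (κ.obj (h.obj X)) (κ.obj (h.obj Y))) v, (∀ n, P (u n)) →
      Conv CGc u v → P v)
    (u : CGc.Hom (κ.obj (h.obj X)) (κ.obj (h.obj Y))) : P u := by
  obtain ⟨f, hf⟩ := dense_seq hκ u
  refine hconv _ _ (fun n => ?_) hf
  refine ins_induction (P := fun v => P (κ.map v)) ?_ ?_ hins (f n)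
  · rw [κ.map_zero]; exact h0
  · intro u v hu hv
    rw [κ.map_add]; exact hadd _ _ hu hv

open Classical in
theorem exists_additive (h : IsCrossedProductAlg G C α CG) (X Y : C.Obj) {M : Type}
    [AddCommGroup M] (p : ∀ g : G, C.Hom X (α.actObj g⁻¹ Y) →+ M) :
    ∃ F : CG.Hom (h.obj X) (h.obj Y) →+ M, ∀ g f, F (h.ins g f) = p g f := by
  let Φ : (Π₀ g : G, C.Hom X (α.actObj g⁻¹ Y)) →+ CG.Hom (h.obj X) (h.obj Y) :=
    DFinsupp.liftAddHom fun g => AddMonoidHom.mk' (fun f => h.ins g f) (h.ins_add g X Y)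
  have hΦ : ∀ g f, Φ (DFinsupp.single g f) = h.ins g f := fun g f =>
    DFinsupp.liftAddHom_apply_single
      (fun g => AddMonoidHom.mk' (fun f => h.ins g f) (h.ins_add g X Y)) g f
  have hinj : Function.Injective Φ := by
    rw [injective_iff_map_eq_zero]
    intro a ha
    have h1 : Φ a = ∑ g ∈ a.support, h.ins g (a g) := by
      conv_lhs => rw [← DFinsupp.sum_single (f := a)]
      rw [DFinsupp.sum, map_sum]
      exact Finset.sum_congr rfl fun g _ => hΦ g _
    rw [h1] at ha
    have := h.indep X Y _ _ ha
    ext1 g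
    by_cases hg : g ∈ a.support
    · exact this g hg
    · simpa using hg
  have hsurj : Function.Surjective Φ := by
    intro u
    obtain ⟨s, φ, rfl⟩ := h.span X Y u
    refine ⟨∑ g ∈ s, DFinsupp.single g (φ g), ?_⟩
    rw [map_sum]
    exact Finset.sum_congr rfl fun g _ => hΦ g _
  let e := AddEquiv.ofBijective Φ ⟨hinj, hsurj⟩
  refine ⟨(DFinsupp.liftAddHom p).comp e.symm.toAddMonoidHom, fun g f => ?_⟩
  have : e.symm (h.ins g f) = DFinsupp.single g f := by
    rw [AddEquiv.symm_apply_eq]; exact (hΦ g f).symm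
  show DFinsupp.liftAddHom p (e.symm (h.ins g f)) = _
  rw [this]
  exact DFinsupp.liftAddHom_apply_single p g f

end crossed

section covrep

variable {G : Type} [Group G] {C : StarCatNu} {α : GAction G C} {D : StarCatNu}
  (R : CovariantRep G C α D)

/-- The unitaries of a covariant representation with prescribed target. -/
def pi (g : G) {X X' : C.Obj} (e : α.actObj g X = X') : D.Hom (R.ρ.obj X) (R.ρ.obj X') :=
  D.castHom rfl (congrArg R.ρ.obj e) (R.π g X)

variable {R}

theorem pi_unitary {g : G} {X X' : C.Obj} (e : α.actObj g X = X') : IsUnitary D (pi R g e) := by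
  subst e; exact R.π_unitary g X

theorem pi_natural {g : G} {X Y X' Y' : C.Obj} (eX : α.actObj g X = X') (eY : α.actObj g Y = Y')
    (f : C.Hom X Y) :
    D.comp (pi R g eY) (R.ρ.map f) = D.comp (R.ρ.map (act α g eX eY f)) (pi R g eX) := by
  subst eX eY; exact R.π_natural g X Y f

theorem pi_mul {g g' : G} {X Y Z : C.Obj} (e : α.actObj g X = Y) (e' : α.actObj g' Y = Z)
    (E : α.actObj (g' * g) X = Z) :
    D.comp (pi R g' e') (pi R g e) = pi R (g' * g) E := by
  subst e e'
  unfold pi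
  rw [← R.π_mul, cast_cast]
  rfl

theorem pi_congr {g g' : G} (hg : g = g') {X X' : C.Obj} (e : α.actObj g X = X')
    (e' : α.actObj g' X = X') : pi R g e = pi R g' e' := by
  subst hg; rfl

theorem pi_one {g : G} (hg : g = 1) {X : C.Obj} (e : α.actObj g X = X) :
    IsIdentityAt D (pi R g e) := by
  subst hg
  have hu := pi_unitary (R := R) e
  have h1 : D.comp (pi R 1 e) (pi R 1 e) = pi R 1 e := by
    rw [pi_mul e e (mul_obj_eq e e)]
    exact pi_congr (mul_one 1) _ _
  have h2 : pi R 1 e = D.comp (D.star (pi R 1 e)) (pi R 1 e) := by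
    have h3 := hu.1.2 _ (pi R 1 e)
    rw [D.comp_assoc, h1] at h3
    exact h3.symm
  rw [h2]; exact hu.1

theorem pi_inv {g : G} {X Y : C.Obj} (e : α.actObj g X = Y) (e' : α.actObj g⁻¹ Y = X) :
    pi R g⁻¹ e' = D.star (pi R g e) := by
  have hu := pi_unitary (R := R) e
  have h1 : IsIdentityAt D (D.comp (pi R g⁻¹ e') (pi R g e)) := by
    rw [pi_mul e e' (mul_obj_eq e e')]
    exact pi_one (inv_mul_cancel g) _
  rw [← hu.2.1 _ (pi R g⁻¹ e'), ← D.comp_assoc, h1.2]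

/-- The value of the induced morphism on generators. -/
theorem exists_alg {CG : StarCatNu} (h : IsCrossedProductAlg G C α CG) :
    ∃ (F : StarFunctor CG D) (ho : ∀ X, F.obj (h.obj X) = R.ρ.obj X),
      ∀ (g : G) (X Y Y' : C.Obj) (e : α.actObj g⁻¹ Y = Y') (e' : α.actObj g Y' = Y)
        (f : C.Hom X Y'),
        D.castHom (ho X) (ho Y) (F.map (ins h g e f)) = D.comp (pi R g e') (R.ρ.map f) := by
  have hex : ∀ X Y : C.Obj, ∃ m : CG.Hom (h.obj X) (h.obj Y) →+ D.Hom (R.ρ.obj X) (R.ρ.obj Y),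
      ∀ g f, m (h.ins g f) = D.comp (pi R g (α.cancel_obj g Y)) (R.ρ.map f) := fun X Y =>
    exists_additive h X Y fun g =>
      AddMonoidHom.mk' (fun f => D.comp (pi R g (α.cancel_obj g Y)) (R.ρ.map f)) fun a b => by
        rw [R.ρ.map_add, D.comp_add]
  choose m hm using hex
  have hm' : ∀ (g : G) (X Y Y' : C.Obj) (e : α.actObj g⁻¹ Y = Y') (e' : α.actObj g Y' = Y)
        (f : C.Hom X Y'), m X Y (ins h g e f) = D.comp (pi R g e') (R.ρ.map f) := by
    intro g X Y Y' e e' f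
    subst e
    exact hm X Y g f
  have hsmul : ∀ X Y (c : ℂ) u, m X Y (c • u) = c • m X Y u := by
    intro X Y c u
    refine ins_induction (P := fun u => m X Y (c • u) = c • m X Y u) ?_ ?_ ?_ u
    · simp
    · intro u v hu hv
      rw [smul_add, map_add, map_add, hu, hv, smul_add]
    · intro g Y' e f
      rw [← ins_smul, hm' _ _ _ _ e (obj_inv e), hm' _ _ _ _ e (obj_inv e), R.ρ.map_smul,
        D.comp_smul]
  have hcomp : ∀ X Y Z v u, m X Z (CG.comp v u) = D.comp (m Y Z v) (m X Y u) := by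
    intro X Y Z v u
    refine ins_induction (P := fun v => m X Z (CG.comp v u) = D.comp (m Y Z v) (m X Y u))
      ?_ ?_ ?_ v
    · rw [CG.zero_comp, map_zero, map_zero, D.zero_comp]
    · intro v v' hv hv'
      rw [CG.add_comp, map_add, map_add, hv, hv', D.add_comp]
    intro g' Z' e' f'
    refine ins_induction (P := fun u => m X Z (CG.comp (ins h g' e' f') u) =
      D.comp (m Y Z (ins h g' e' f')) (m X Y u)) ?_ ?_ ?_ u
    · rw [CG.comp_zero, map_zero, map_zero, D.comp_zero]
    · intro v v' hv hv'
      rw [CG.comp_add, map_add, map_add, hv, hv', D.comp_add]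
    intro g Y' e f
    have e1 := obj_inv e
    have e1' := obj_inv e'
    obtain ⟨Z'', e''⟩ : ∃ Z'', α.actObj g⁻¹ Z' = Z'' := ⟨_, rfl⟩
    have e1'' := obj_inv e''
    have E1 := mul_obj_eq e1'' e1'
    have E := inv_obj E1
    rw [ins_comp e e' e'' E, hm' _ _ _ _ E E1, hm' _ _ _ _ e e1, hm' _ _ _ _ e' e1',
      R.ρ.map_comp, ← pi_mul e1'' e1' E1]
    rw [D.comp_assoc, ← D.comp_assoc (pi R g e1''), pi_natural e1 e1'',
      act_cancel_inv e1 e1'' e e'']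
    simp only [D.comp_assoc]
  have hstar : ∀ X Y u, m Y X (CG.star u) = D.star (m X Y u) := by
    intro X Y u
    refine ins_induction (P := fun u => m Y X (CG.star u) = D.star (m X Y u)) ?_ ?_ ?_ u
    · rw [CG.star_zero', map_zero, map_zero, D.star_zero']
    · intro v v' hv hv'
      rw [CG.star_add, map_add, map_add, hv, hv', D.star_add]
    intro g Y' e f
    have e1 := obj_inv e
    obtain ⟨X', e2⟩ : ∃ X', α.actObj g X = X' := ⟨_, rfl⟩
    have E : α.actObj g⁻¹⁻¹ X = X' := by rw [inv_inv, e2]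
    have e3 := inv_obj e2
    rw [ins_star e e1 e2 E, hm' _ _ _ _ E e3, hm' _ _ _ _ e e1, pi_natural e e3,
      act_inv_cancel e1 e2 e e3, D.star_comp, pi_inv e1 e, R.ρ.map_star]
  let E : StarFunctor (pull CG h.obj) D :=
    { obj := R.ρ.obj
      map := fun {X Y} u => m X Y u
      map_add := fun X Y => (m X Y).map_add
      map_smul := hsmul
      map_comp := hcomp
      map_star := hstar }
  obtain ⟨F, ho, hF⟩ := exists_lift h.obj h.obj_bij E
  refine ⟨F, ho, fun g X Y Y' e e' f => (hF X Y _).trans (hm' _ _ _ _ e e' f)⟩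

end covrep

section main

variable {G : Type} [Group G] {C : StarCatNu} {α : GAction G C} {D : StarCatNu}
  {CG CGc : StarCatNu} {h : IsCrossedProductAlg G C α CG} {κ : StarFunctor CG CGc}

theorem induces_ins {R : CovariantRep G C α D} {σ : StarFunctor CGc D} (hσ : Induces h κ R σ)
    {g : G} {X Y Y' : C.Obj} (e : α.actObj g⁻¹ Y = Y') (e' : α.actObj g Y' = Y)
    (f : C.Hom X Y') :
    D.castHom (hσ.obj_eq X) (hσ.obj_eq Y) (σ.map (κ.map (ins h g e f))) =
      D.comp (pi R g e') (R.ρ.map f) := by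
  subst e
  refine (hσ.map_eq g X Y f).trans ?_
  rw [cast_comp D rfl rfl (congrArg R.ρ.obj (α.cancel_obj g Y))]
  rfl

theorem obj_surj (hκ : IsCompletion CG CGc κ) (h : IsCrossedProductAlg G C α CG) (A : CGc.Obj) :
    ∃ X, κ.obj (h.obj X) = A := by
  obtain ⟨B, rfl⟩ := hκ.obj_bij.2 A
  obtain ⟨X, rfl⟩ := h.obj_bij.2 B
  exact ⟨X, rfl⟩

theorem obj_inj (hκ : IsCompletion CG CGc κ) (h : IsCrossedProductAlg G C α CG) {X Y : C.Obj}
    (e : κ.obj (h.obj X) = κ.obj (h.obj Y)) : X = Y :=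
  h.obj_bij.1 (hκ.obj_bij.1 e)

theorem induced_exists (hD : IsCStar D) (hκ : IsCompletion CG CGc κ) (R : CovariantRep G C α D) :
    ∃ σ : StarFunctor CGc D, Induces h κ R σ := by
  obtain ⟨F, ho, hF⟩ := exists_alg (R := R) h
  obtain ⟨σ, ho', hσ⟩ := exists_extension hκ hD F
  refine ⟨σ, ⟨fun X => (ho' _).trans (ho X), fun g X Y f => ?_⟩⟩
  rw [← cast_cast (ho' _) (ho' _), hσ, cast_comp D rfl rfl (congrArg R.ρ.obj (α.cancel_obj g Y))]
  exact hF g X Y _ rfl (α.cancel_obj g Y) f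

theorem induced_unique (hD : IsCStar D) (hκ : IsCompletion CG CGc κ) {R : CovariantRep G C α D}
    {σ σ' : StarFunctor CGc D} (hσ : Induces h κ R σ) (hσ' : Induces h κ R σ') : σ = σ' := by
  have ho : ∀ A, σ.obj A = σ'.obj A := by
    intro A
    obtain ⟨X, rfl⟩ := obj_surj hκ h A
    rw [hσ.obj_eq, hσ'.obj_eq]
  refine functor_ext ho ?_
  intro A B u
  obtain ⟨X, rfl⟩ := obj_surj hκ h A
  obtain ⟨Y, rfl⟩ := obj_surj hκ h B
  refine dense_induction hκ (P := fun u => D.castHom (ho _) (ho _) (σ.map u) = σ'.map u)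
    ?_ ?_ ?_ ?_ u
  · rw [σ.map_zero, σ'.map_zero, cast_zero]
  · intro u v hu hv
    rw [σ.map_add, σ'.map_add, cast_add, hu, hv]
  · intro g Y' e f
    apply cast_inj (hσ'.obj_eq X) (hσ'.obj_eq Y)
    rw [cast_cast, induces_ins hσ' e (obj_inv e)]
    exact induces_ins hσ e (obj_inv e) f
  · intro u v hu hv
    refine Conv.unique hD ((hv.map σ).cast (ho _) (ho _)) ?_
    simp only [hu]
    exact hv.map σ'

theorem trans_induced (hD : IsCStar D) (hκ : IsCompletion CG CGc κ) {R R' : CovariantRep G C α D}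
    {σ σ' : StarFunctor CGc D} (hσ : Induces h κ R σ) (hσ' : Induces h κ R' σ')
    (t : CovRepTrans R R') :
    ∃ u : UnitaryTrans σ σ', ∀ X : C.Obj,
        D.castHom (hσ.obj_eq X) (hσ'.obj_eq X) (u.app (κ.obj (h.obj X))) = t.app X := by
  have key : ∀ A : CGc.Obj, ∃ v : D.Hom (σ.obj A) (σ'.obj A), ∀ X (e : A = κ.obj (h.obj X)),
      D.castHom ((congrArg σ.obj e).trans (hσ.obj_eq X))
        ((congrArg σ'.obj e).trans (hσ'.obj_eq X)) v = t.app X := by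
    intro A
    obtain ⟨X, rfl⟩ := obj_surj hκ h A
    refine ⟨D.castHom (hσ.obj_eq X).symm (hσ'.obj_eq X).symm (t.app X), fun X' e => ?_⟩
    obtain rfl := obj_inj hκ h e
    rw [cast_cast]
    rfl
  choose v hv using key
  have hv' : ∀ X, D.castHom (hσ.obj_eq X) (hσ'.obj_eq X) (v (κ.obj (h.obj X))) = t.app X :=
    fun X => hv _ X rfl
  have compat : ∀ (g : G) (X X' : C.Obj) (e : α.actObj g X = X'),
      D.comp (pi R' g e) (t.app X) = D.comp (t.app X') (pi R g e) := by
    intro g X X' e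
    subst e
    exact t.compat g X
  refine ⟨⟨v, ?_, ?_⟩, hv'⟩
  · intro A B u
    obtain ⟨X, rfl⟩ := obj_surj hκ h A
    obtain ⟨Y, rfl⟩ := obj_surj hκ h B
    refine dense_induction hκ (P := fun u => D.comp (v _) (σ.map u) = D.comp (σ'.map u) (v _))
      ?_ ?_ ?_ ?_ u
    · rw [σ.map_zero, σ'.map_zero, D.zero_comp, D.comp_zero]
    · intro u v hu hv
      rw [σ.map_add, σ'.map_add, D.add_comp, D.comp_add, hu, hv]
    · intro g Y' e f
      apply cast_inj (hσ.obj_eq X) (hσ'.obj_eq Y)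
      rw [cast_comp D (hσ.obj_eq X) (hσ.obj_eq Y) (hσ'.obj_eq Y),
        cast_comp D (hσ.obj_eq X) (hσ'.obj_eq X) (hσ'.obj_eq Y),
        induces_ins hσ e (obj_inv e), induces_ins hσ' e (obj_inv e), hv', hv',
        D.comp_assoc, ← t.natural, ← D.comp_assoc, ← D.comp_assoc, compat]
    · intro u w hu hw
      refine Conv.unique hD (Conv.comp hD.1 (conv_const (v _)) (hw.map σ)) ?_
      simp only [hu]
      exact Conv.comp hD.1 (hw.map σ') (conv_const _)
  · intro A
    obtain ⟨X, rfl⟩ := obj_surj hκ h A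
    have := isUnitary_cast (hσ.obj_eq X).symm (hσ'.obj_eq X).symm (t.unitary X)
    rw [← hv', cast_cast] at this
    exact this

/-! ### The unital case -/

theorem ins_identity (h : IsCrossedProductAlg G C α CG) {X : C.Obj} {i : C.Hom X X}
    (hi : IsIdentityAt C i) {g : G} (hg : g = 1) (e : α.actObj g⁻¹ X = X) :
    IsIdentityAt CG (ins h g e i) := by
  subst hg
  have h1 : ∀ Y : C.Obj, α.actObj (1 : G)⁻¹ Y = Y := α.one_inv_obj
  refine ⟨fun B u => ?_, fun B u => ?_⟩
  · obtain ⟨Y, rfl⟩ := h.obj_bij.2 B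
    refine ins_induction (P := fun u => CG.comp u (ins h 1 e i) = u) ?_ ?_ ?_ u
    · rw [CG.zero_comp]
    · intro u v hu hv
      rw [CG.add_comp, hu, hv]
    · intro g Y' e' f
      rw [ins_comp e e' (h1 _) (by rw [mul_one, e']), hi.1, act_one inv_one]
      exact ins_congr (mul_one g) _ _ _
  · obtain ⟨Y, rfl⟩ := h.obj_bij.2 B
    refine ins_induction (P := fun u => CG.comp (ins h 1 e i) u = u) ?_ ?_ ?_ u
    · rw [CG.comp_zero]
    · intro u v hu hv
      rw [CG.comp_add, hu, hv]
    · intro g Y' e' f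
      rw [ins_comp e' e e' (by rw [one_mul, e']), (act_identity e' hi).2]
      exact ins_congr (one_mul g) _ _ _

theorem completion_identity (hκ : IsCompletion CG CGc κ) {B : CG.Obj} {i : CG.Hom B B}
    (hi : IsIdentityAt CG i) : IsIdentityAt CGc (κ.map i) := by
  refine ⟨fun A u => ?_, fun A u => ?_⟩
  · obtain ⟨A, rfl⟩ := hκ.obj_bij.2 A
    obtain ⟨f, hf⟩ := dense_seq hκ u
    refine Conv.unique hκ.cstar (Conv.comp hκ.cstar.1 hf (conv_const _)) ?_
    simp only [← κ.map_comp, hi.1]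
    exact hf
  · obtain ⟨A, rfl⟩ := hκ.obj_bij.2 A
    obtain ⟨f, hf⟩ := dense_seq hκ u
    refine Conv.unique hκ.cstar (Conv.comp hκ.cstar.1 (conv_const _) hf) ?_
    simp only [← κ.map_comp, hi.2]
    exact hf

theorem induced_unital (hκ : IsCompletion CG CGc κ) (hu : C.IsUnital)
    {R : CovariantRep G C α D} (hR : R.ρ.Unital) {σ : StarFunctor CGc D}
    (hσ : Induces h κ R σ) : σ.Unital := by
  intro A i hi
  obtain ⟨X, rfl⟩ := obj_surj hκ h A
  obtain ⟨e, he⟩ := hu X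
  have h1 : α.actObj (1 : G)⁻¹ X = X := α.one_inv_obj X
  have h2 : α.actObj (1 : G) X = X := α.one_obj X
  rw [identity_unique hi (completion_identity hκ (ins_identity h he rfl h1))]
  have h3 := induces_ins hσ h1 h2 e
  rw [(hR X e he).1] at h3
  have h4 := isIdentityAt_cast (hσ.obj_eq X).symm (pi_one (R := R) rfl h2)
  rw [← h3, cast_cast] at h4
  exact h4

theorem rho_eq {R : CovariantRep G C α D} {σ : StarFunctor CGc D} (hσ : Induces h κ R σ)
    {X Y : C.Obj} (e : α.actObj (1 : G)⁻¹ Y = Y) (f : C.Hom X Y) :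
    D.castHom (hσ.obj_eq X) (hσ.obj_eq Y) (σ.map (κ.map (ins h 1 e f))) = R.ρ.map f := by
  rw [induces_ins hσ e (α.one_obj Y)]
  exact (pi_one rfl _).2 _ _

theorem pi_eq {R : CovariantRep G C α D} (hR : R.ρ.Unital) {σ : StarFunctor CGc D}
    (hσ : Induces h κ R σ) {X X' : C.Obj} {i : C.Hom X X} (hi : IsIdentityAt C i) {g : G}
    (e : α.actObj g⁻¹ X' = X) (e' : α.actObj g X = X') :
    D.castHom (hσ.obj_eq X) (hσ.obj_eq X') (σ.map (κ.map (ins h g e i))) = pi R g e' := by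
  rw [induces_ins hσ e e']
  exact (hR X i hi).1 _ _

theorem covrep_ext {R R' : CovariantRep G C α D} (ho : ∀ X, R.ρ.obj X = R'.ρ.obj X)
    (hm : ∀ X Y (f : C.Hom X Y), D.castHom (ho X) (ho Y) (R.ρ.map f) = R'.ρ.map f)
    (hp : ∀ g X, D.castHom (ho X) (ho _) (R.π g X) = R'.π g X) : R = R' := by
  obtain ⟨ρ, π, _, _, _⟩ := R
  obtain ⟨ρ', π', _, _, _⟩ := R'
  obtain rfl : ρ = ρ' := functor_ext ho hm
  obtain rfl : π = π' := by
    funext g X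
    exact hp g X
  rfl

theorem covrep_unique (hu : C.IsUnital) {R R' : CovariantRep G C α D} (hR : R.ρ.Unital)
    (hR' : R'.ρ.Unital) {σ : StarFunctor CGc D} (hσ : Induces h κ R σ) (hσ' : Induces h κ R' σ) :
    R = R' := by
  refine covrep_ext (fun X => (hσ.obj_eq X).symm.trans (hσ'.obj_eq X)) ?_ ?_
  · intro X Y f
    rw [← rho_eq hσ (α.one_inv_obj Y), ← rho_eq hσ' (α.one_inv_obj Y), cast_cast]
  · intro g X
    obtain ⟨i, hi⟩ := hu X
    have e : α.actObj g X = α.actObj g X := rfl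
    have h1 := pi_eq hR hσ hi (inv_obj e) e
    have h2 := pi_eq hR' hσ' hi (inv_obj e) e
    change _ = R.π g X at h1
    change _ = R'.π g X at h2
    rw [← h1, ← h2, cast_cast]

/-- The canonical functor from `C` to the algebraic crossed product. -/
def incl (h : IsCrossedProductAlg G C α CG) : StarFunctor C CG where
  obj := h.obj
  map {X Y} f := ins h 1 (α.one_inv_obj Y) f
  map_add _ _ _ _ := ins_add _ _ _
  map_smul _ _ _ _ := ins_smul _ _ _
  map_comp X Y Z g f := by
    rw [ins_comp (α.one_inv_obj Y) (α.one_inv_obj Z) (α.one_inv_obj Z)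
      (by rw [mul_one]; exact α.one_inv_obj Z), act_one inv_one]
    exact ins_congr (mul_one 1).symm _ _ _
  map_star X Y f := by
    rw [ins_star (α.one_inv_obj Y) (α.one_obj Y) (α.one_obj X)
      (by rw [inv_inv]; exact α.one_obj X), act_one rfl]
    exact ins_congr inv_one.symm _ _ _

theorem covrep_exists (hκ : IsCompletion CG CGc κ) (hu : C.IsUnital) (σ : StarFunctor CGc D)
    (hσ : σ.Unital) : ∃ R : CovariantRep G C α D, R.ρ.Unital ∧ Induces h κ R σ := by
  choose i hi using hu
  -- the canonical unitaries
  let U : ∀ (g : G) (X X' : C.Obj), α.actObj g X = X' → CG.Hom (h.obj X) (h.obj X') :=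
    fun g X X' e => ins h g (inv_obj e) (i X)
  have Umul : ∀ (g g' : G) (X Y Z : C.Obj) (e : α.actObj g X = Y) (e' : α.actObj g' Y = Z)
      (E : α.actObj (g' * g) X = Z), CG.comp (U g' Y Z e') (U g X Y e) = U (g' * g) X Z E := by
    intro g g' X Y Z e e' E
    show CG.comp (ins h g' _ _) (ins h g _ _) = ins h _ _ _
    rw [ins_comp (inv_obj e) (inv_obj e') (inv_obj e) (inv_obj E), (hi X).1,
      identity_unique (act_identity (inv_obj e) (hi Y)) (hi X)]
  have Uone : ∀ (g : G) (X : C.Obj) (e : α.actObj g X = X), g = 1 →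
      IsIdentityAt CG (U g X X e) := fun g X e hg => ins_identity h (hi X) hg _
  have Ustar : ∀ (g : G) (X Y : C.Obj) (e : α.actObj g X = Y) (e' : α.actObj g⁻¹ Y = X),
      CG.star (U g X Y e) = U g⁻¹ Y X e' := by
    intro g X Y e e'
    show CG.star (ins h g _ _) = ins h _ _ _
    rw [ins_star (inv_obj e) e e (by rw [inv_inv, e]), identity_star (hi X),
      identity_unique (act_identity e (hi X)) (hi Y)]
  have Uins : ∀ (g : G) (X Y' Y : C.Obj) (e : α.actObj g Y' = Y) (f : C.Hom X Y'),
      CG.comp (U g Y' Y e) (ins h 1 (α.one_inv_obj Y') f) = ins h g (inv_obj e) f := by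
    intro g X Y' Y e f
    show CG.comp (ins h g _ _) (ins h 1 (α.one_inv_obj Y') _) = ins h _ _ _
    rw [ins_comp (α.one_inv_obj _) (inv_obj e) (α.one_inv_obj _) (by rw [mul_one]; exact inv_obj e),
      act_one inv_one, (hi Y').2]
    exact ins_congr (mul_one g) _ _ _
  have insU : ∀ (g : G) (X Y X' Y' : C.Obj) (eX : α.actObj g X = X') (eY : α.actObj g Y = Y')
      (f : C.Hom X Y), CG.comp (ins h 1 (α.one_inv_obj Y') (act α g eX eY f)) (U g X X' eX) =
        ins h g (inv_obj eY) f := by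
    intro g X Y X' Y' eX eY f
    show CG.comp (ins h 1 (α.one_inv_obj Y') _) (ins h g _ _) = ins h _ _ _
    rw [ins_comp (inv_obj eX) (α.one_inv_obj _) (inv_obj eY)
      (by rw [one_mul]; exact inv_obj eY), act_inv_cancel, (hi X).1]
    exact ins_congr (one_mul g) _ _ _
  clear_value U
  have ident : ∀ (g : G) (X : C.Obj) (e : α.actObj g X = X), g = 1 →
      IsIdentityAt D (σ.map (κ.map (U g X X e))) := fun g X e hg =>
    hσ _ _ (completion_identity hκ (Uone g X e hg))
  have Uuni : ∀ (g : G) (X Y : C.Obj) (e : α.actObj g X = Y),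
      IsUnitary D (σ.map (κ.map (U g X Y e))) := by
    intro g X Y e
    have e' := inv_obj e
    unfold IsUnitary
    rw [← σ.map_star, ← κ.map_star, ← σ.map_comp, ← σ.map_comp, ← κ.map_comp, ← κ.map_comp,
      Ustar g X Y e e', Umul _ _ _ _ _ e e' (mul_obj_eq e e'),
      Umul _ _ _ _ _ e' e (mul_obj_eq e' e)]
    exact ⟨ident _ X (mul_obj_eq e e') (inv_mul_cancel g),
      ident _ Y (mul_obj_eq e' e) (mul_inv_cancel g)⟩
  have Ucast : ∀ (g : G) (X Y Y' : C.Obj) (e : α.actObj g X = Y) (q : Y = Y')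
      (p : σ.obj (κ.obj (h.obj Y)) = σ.obj (κ.obj (h.obj Y'))),
      D.castHom rfl p (σ.map (κ.map (U g X Y e))) = σ.map (κ.map (U g X Y' (e.trans q))) := by
    intro g X Y Y' e q p
    subst q
    rfl
  have Dnat : ∀ (g : G) (X Y X' Y' : C.Obj) (eX : α.actObj g X = X') (eY : α.actObj g Y = Y')
      (f : C.Hom X Y), D.comp (σ.map (κ.map (U g Y Y' eY)))
          (σ.map (κ.map (ins h 1 (α.one_inv_obj Y) f))) =
        D.comp (σ.map (κ.map (ins h 1 (α.one_inv_obj Y') (act α g eX eY f))))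
          (σ.map (κ.map (U g X X' eX))) := by
    intro g X Y X' Y' eX eY f
    rw [← σ.map_comp, ← σ.map_comp, ← κ.map_comp, ← κ.map_comp,
      Uins g X Y Y' eY f, insU g X Y X' Y' eX eY f]
  have Dmul : ∀ (g g' : G) (X Y Z Z' : C.Obj) (e : α.actObj g X = Y) (e' : α.actObj g' Y = Z)
      (q : Z = Z') (p : σ.obj (κ.obj (h.obj Z)) = σ.obj (κ.obj (h.obj Z')))
      (E : α.actObj (g' * g) X = Z'),
      D.castHom rfl p (D.comp (σ.map (κ.map (U g' Y Z e'))) (σ.map (κ.map (U g X Y e)))) =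
        σ.map (κ.map (U (g' * g) X Z' E)) := by
    intro g g' X Y Z Z' e e' q p E
    rw [← σ.map_comp, ← κ.map_comp, Umul g g' X Y Z e e' (mul_obj_eq e e'),
      Ucast (g' * g) X Z Z' (mul_obj_eq e e') q p]
  have Dins : ∀ (g : G) (X Y' Y Z : C.Obj) (e : α.actObj g Y' = Y) (q : Y = Z)
      (p : σ.obj (κ.obj (h.obj Y)) = σ.obj (κ.obj (h.obj Z))) (E : α.actObj g⁻¹ Z = Y')
      (f : C.Hom X Y'),
      σ.map (κ.map (ins h g E f)) = D.castHom rfl p (D.comp (σ.map (κ.map (U g Y' Y e)))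
          (σ.map (κ.map (ins h 1 (α.one_inv_obj Y') f)))) := by
    intro g X Y' Y Z e q p E f
    subst q
    rw [← σ.map_comp, ← κ.map_comp, Uins g X Y' Y e f]
    rfl
  exact ⟨{  ρ := ((incl h).comp κ).comp σ
            π := fun g X => σ.map (κ.map (U g X _ rfl))
            π_unitary := fun g X => Uuni g X _ rfl
            π_natural := fun g X Y f => Dnat g X Y _ _ rfl rfl f
            π_mul := fun g g' X => Dmul g g' X _ _ _ rfl rfl (α.mul_obj g' g X)
              (congrArg (fun X => σ.obj (κ.obj (h.obj X))) (α.mul_obj g' g X)) rfl },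
    fun X e he => hσ _ _ (completion_identity hκ (ins_identity h he rfl (α.one_inv_obj X))),
    ⟨fun X => rfl, fun g X Y f => Dins g X _ _ Y rfl (α.cancel_obj g Y)
      (congrArg (fun X => σ.obj (κ.obj (h.obj X))) (α.cancel_obj g Y)) rfl f⟩⟩

theorem covtrans_exists (hu : C.IsUnital)
    {R R' : CovariantRep G C α D} {σ σ' : StarFunctor CGc D} (hR : R.ρ.Unital)
    (hR' : R'.ρ.Unital) (hσ : Induces h κ R σ) (hσ' : Induces h κ R' σ')
    (u : UnitaryTrans σ σ') :
    ∃! t : CovRepTrans R R', ∀ X : C.Obj,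
      D.castHom (hσ.obj_eq X) (hσ'.obj_eq X) (u.app (κ.obj (h.obj X))) = t.app X := by
  refine ⟨⟨fun X => D.castHom (hσ.obj_eq X) (hσ'.obj_eq X) (u.app (κ.obj (h.obj X))),
    fun X Y f => ?_, fun X => isUnitary_cast _ _ (u.unitary _), fun g X => ?_⟩, fun X => rfl, ?_⟩
  · rw [← rho_eq hσ (α.one_inv_obj Y), ← rho_eq hσ' (α.one_inv_obj Y), ← cast_comp, ← cast_comp,
      u.natural]
  · obtain ⟨i, hi⟩ := hu X
    have e : α.actObj g X = α.actObj g X := rfl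
    have h1 := pi_eq hR hσ hi (inv_obj e) e
    have h2 := pi_eq hR' hσ' hi (inv_obj e) e
    change _ = R.π g X at h1
    change _ = R'.π g X at h2
    rw [← h1, ← h2, ← cast_comp, ← cast_comp, u.natural]
  · rintro ⟨a, _, _, _⟩ ht
    have : a = fun X => D.castHom (hσ.obj_eq X) (hσ'.obj_eq X) (u.app (κ.obj (h.obj X))) :=
      funext fun X => (ht X).symm
    subst this
    rfl

end main

end CovAux

/-- Let `G` be a group, `C` a possibly non-unital small C*-category with
`G`-action, and `D` a possibly non-unital small C*-category.
(1) Every covariant representation `(ρ, π)` of `C` on `D` induces a (unique) morphism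
`σ : C ⋊ G → D`, and every unitary natural transformation `(ρ, π) → (ρ', π')` of
covariant representations induces a unitary isomorphism `σ → σ'` of the induced
morphisms.
(2) If `C` is unital, this construction is an isomorphism between the groupoid of
covariant representations `(ρ, π)` with unital `ρ` and unitary natural transformations,
and the groupoid of unital morphisms `C ⋊ G → D` and unitary isomorphisms. -/
theorem covariant_representations_of_crossed_product
    (G : Type) [Group G] (C : StarCatNu) (hC : IsCStar C) (α : GAction G C)
    (D : StarCatNu) (hD : IsCStar D)
    (CG : StarCatNu) (h : IsCrossedProductAlg G C α CG)
    (CGc : StarCatNu) (κ : StarFunctor CG CGc) (hκ : IsCompletion CG CGc κ) :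
    -- (1a) every covariant representation induces a morphism `C ⋊ G → D`
    (∀ R : CovariantRep G C α D, ∃! σ : StarFunctor CGc D, Induces h κ R σ) ∧
    -- (1b) a unitary transformation of covariant representations induces a unitary
    -- isomorphism of the induced morphisms
    (∀ (R R' : CovariantRep G C α D) (σ σ' : StarFunctor CGc D)
      (hσ : Induces h κ R σ) (hσ' : Induces h κ R' σ') (t : CovRepTrans R R'),
      ∃ u : UnitaryTrans σ σ', ∀ X : C.Obj,
        D.castHom (hσ.obj_eq X) (hσ'.obj_eq X)
          (u.app (κ.obj (h.obj X))) = t.app X) ∧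
    -- (2) if `C` is unital, the correspondence is an isomorphism of groupoids
    (C.IsUnital →
      (∀ σ : StarFunctor CGc D, σ.Unital →
        ∃! R : CovariantRep G C α D, R.ρ.Unital ∧ Induces h κ R σ) ∧
      (∀ R : CovariantRep G C α D, R.ρ.Unital →
        ∃! σ : StarFunctor CGc D, σ.Unital ∧ Induces h κ R σ) ∧
      (∀ (R R' : CovariantRep G C α D) (σ σ' : StarFunctor CGc D),
        R.ρ.Unital → R'.ρ.Unital →
        ∀ (hσ : Induces h κ R σ) (hσ' : Induces h κ R' σ') (u : UnitaryTrans σ σ'),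
        ∃! t : CovRepTrans R R', ∀ X : C.Obj,
          D.castHom (hσ.obj_eq X) (hσ'.obj_eq X) (u.app (κ.obj (h.obj X))) = t.app X)) := by
  refine ⟨fun R => ?_, fun R R' σ σ' hσ hσ' t => CovAux.trans_induced hD hκ hσ hσ' t,
    fun hu => ⟨fun σ hσ => ?_, fun R hR => ?_, ?_⟩⟩
  · obtain ⟨σ, hσ⟩ := CovAux.induced_exists (h := h) hD hκ R
    exact ⟨σ, hσ, fun σ' hσ' => CovAux.induced_unique hD hκ hσ' hσ⟩
  · obtain ⟨R, hR⟩ := CovAux.covrep_exists (h := h) hκ hu σ hσ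
    exact ⟨R, hR, fun R' hR' => CovAux.covrep_unique hu hR'.1 hR.1 hR'.2 hR.2⟩
  · obtain ⟨σ, hσ⟩ := CovAux.induced_exists (h := h) hD hκ R
    exact ⟨σ, ⟨CovAux.induced_unital hκ hu hR hσ, hσ⟩,
      fun σ' hσ' => CovAux.induced_unique hD hκ hσ'.2 hσ⟩
  · intro R R' σ σ' hR hR' hσ hσ' u
    exact CovAux.covtrans_exists hu hR hR' hσ hσ' u
end
end

section
/- Let A be a possibly non-unital C*-algebra with an action of a group G. Then the canonical homomorphism A⋊G → A⋊^{C*}G, from the completion of A⋊^alg G in the maximal semi-norm to the classical maximal crossed product, is an isomorphism of C*-algebras; equivalently, the norms ‖·‖_max and ‖·‖_{C*} coincide on A⋊^alg G. -/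
noncomputable section

open scoped ENNReal

/-- An action of a group `G` on a ∗-algebra over ℂ by ∗-automorphisms. -/
structure AlgGAction (G : Type) [Group G] (A : Type) [NonUnitalRing A] [Module ℂ A]
    [SMulCommClass ℂ A A] [IsScalarTower ℂ A A] [StarRing A] [StarModule ℂ A] where
  act : G → A → A
  one_act : ∀ a : A, act 1 a = a
  mul_act : ∀ (g h : G) (a : A), act g (act h a) = act (g * h) a
  map_add : ∀ (g : G) (a b : A), act g (a + b) = act g a + act g b
  map_smul : ∀ (g : G) (c : ℂ) (a : A), act g (c • a) = c • act g a
  map_mul : ∀ (g : G) (a b : A), act g (a * b) = act g a * act g b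
  map_star : ∀ (g : G) (a : A), act g (star a) = star (act g a)

/-- `R`, together with the maps `ins g : A → R` (written `a ↦ (a, g)`), is a realization
of the algebraic crossed product `A ⋊^alg G`: underlying vector space `⊕_{g ∈ G} A`,
multiplication `(a', g') (a, g) = ((g⁻¹ a') a, g' g)` and involution
`(a, g)* = (g a*, g⁻¹)`. -/
structure IsAlgCrossedProduct (G : Type) [Group G] (A : Type) [NonUnitalRing A]
    [Module ℂ A] [SMulCommClass ℂ A A] [IsScalarTower ℂ A A] [StarRing A] [StarModule ℂ A]
    (τ : AlgGAction G A)
    (R : Type) [NonUnitalRing R] [Module ℂ R] [SMulCommClass ℂ R R] [IsScalarTower ℂ R R]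
    [StarRing R] [StarModule ℂ R] where
  ins : G → A → R
  ins_add : ∀ (g : G) (a b : A), ins g (a + b) = ins g a + ins g b
  ins_smul : ∀ (g : G) (c : ℂ) (a : A), ins g (c • a) = c • ins g a
  ins_mul : ∀ (g g' : G) (a a' : A),
    ins g' a' * ins g a = ins (g' * g) (τ.act g⁻¹ a' * a)
  ins_star : ∀ (g : G) (a : A), star (ins g a) = ins g⁻¹ (τ.act g (star a))
  span : ∀ x : R, ∃ (s : Finset G) (φ : G → A), x = s.sum fun g => ins g (φ g)
  indep : ∀ (s : Finset G) (φ : G → A),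
    (s.sum fun g => ins g (φ g)) = 0 → ∀ g ∈ s, φ g = 0

open scoped MultiplierAlgebra in
/-- A covariant representation of the C*-algebra `A` with `G`-action `τ` on the
C*-algebra `D`: a ∗-homomorphism `ρ : A → D` together with a group homomorphism
`μ : G → U(M(D))` into the unitary group of the multiplier algebra of `D` such that
`μ(g) ρ(a) μ(g)⁻¹ = ρ(g a)` for all `g` and `a`. -/
def IsCovariantPair {G : Type} [Group G] {A : Type} [NonUnitalCStarAlgebra A]
    (τ : AlgGAction G A) {D : Type} [NonUnitalCStarAlgebra D]
    (ρ : A →⋆ₙₐ[ℂ] D) (μ : G →* unitary 𝓜(ℂ, D)) : Prop :=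
  ∀ (g : G) (a : A),
    (μ g : 𝓜(ℂ, D)) * (ρ a : 𝓜(ℂ, D)) * ((μ g⁻¹ : unitary 𝓜(ℂ, D)) : 𝓜(ℂ, D)) =
      ((ρ (τ.act g a) : D) : 𝓜(ℂ, D))

open scoped MultiplierAlgebra

/-- The set of values `‖σ x‖` over all covariant representations `(ρ, μ)` of `A` on a
fixed C*-algebra `D`, where `σ` is the induced ∗-homomorphism on the algebraic crossed
product, determined by `σ(a, g) = μ(g) ρ(a)`. -/
def covariantNormValues {G : Type} [Group G] {A : Type} [NonUnitalCStarAlgebra A]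
    (τ : AlgGAction G A) {R : Type} [NonUnitalRing R] [Module ℂ R] [SMulCommClass ℂ R R]
    [IsScalarTower ℂ R R] [StarRing R] [StarModule ℂ R]
    (w : IsAlgCrossedProduct G A τ R) (x : R) (D : Type) [NonUnitalCStarAlgebra D] :
    Set ℝ≥0∞ :=
  { r | ∃ (ρ : A →⋆ₙₐ[ℂ] D) (μ : G →* unitary 𝓜(ℂ, D)) (σ : R →⋆ₙₐ[ℂ] D),
      IsCovariantPair τ ρ μ ∧
      (∀ (g : G) (a : A),
        ((σ (w.ins g a) : D) : 𝓜(ℂ, D)) = (μ g : 𝓜(ℂ, D)) * ((ρ a : D) : 𝓜(ℂ, D))) ∧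
      r = (‖σ x‖₊ : ℝ≥0∞) }

/-- The classical C*-semi-norm `‖·‖_{C*}` on the algebraic crossed product: the supremum
of `‖σ x‖` over all covariant representations. -/
noncomputable def cstarSeminorm {G : Type} [Group G] {A : Type} [NonUnitalCStarAlgebra A]
    (τ : AlgGAction G A) {R : Type} [NonUnitalRing R] [Module ℂ R] [SMulCommClass ℂ R R]
    [IsScalarTower ℂ R R] [StarRing R] [StarModule ℂ R]
    (w : IsAlgCrossedProduct G A τ R) (x : R) : ℝ≥0∞ :=
  sSup { r : ℝ≥0∞ | ∃ (D : Type) (iD : NonUnitalCStarAlgebra D),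
    r ∈ @covariantNormValues G _ A _ τ R _ _ _ _ _ _ w x D iD }

namespace CrossedAux

variable {G : Type} [Group G] {A : Type} [NonUnitalCStarAlgebra A] {τ : AlgGAction G A}
  {R : Type} [NonUnitalRing R] [Module ℂ R] [SMulCommClass ℂ R R]
  [IsScalarTower ℂ R R] [StarRing R] [StarModule ℂ R]

/-- `ins g` as a linear map. -/
def insₗ (w : IsAlgCrossedProduct G A τ R) (g : G) : A →ₗ[ℂ] R where
  toFun := w.ins g
  map_add' := w.ins_add g
  map_smul' := w.ins_smul g

theorem span_induction (w : IsAlgCrossedProduct G A τ R) {p : R → Prop}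
    (h0 : p 0) (hadd : ∀ x y, p x → p y → p (x + y)) (hins : ∀ g a, p (w.ins g a)) (x : R) :
    p x := by
  classical
  obtain ⟨s, φ, rfl⟩ := w.span x
  induction s using Finset.induction_on with
  | empty => simpa using h0
  | insert g s hg ih =>
    rw [Finset.sum_insert hg]
    exact hadd _ _ (hins _ _) ih

/-- The linear map from finitely supported functions. -/
def toR (w : IsAlgCrossedProduct G A τ R) : (G →₀ A) →ₗ[ℂ] R :=
  Finsupp.lsum ℂ (insₗ w)

theorem toR_apply (w : IsAlgCrossedProduct G A τ R) (f : G →₀ A) :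
    toR w f = f.support.sum fun g => w.ins g (f g) := rfl

theorem toR_single (w : IsAlgCrossedProduct G A τ R) (g : G) (a : A) :
    toR w (Finsupp.single g a) = w.ins g a := by
  exact Finsupp.sum_single_index (h := fun g a => insₗ w g a) (map_zero (insₗ w g))

theorem toR_bijective (w : IsAlgCrossedProduct G A τ R) : Function.Bijective (toR w) := by
  constructor
  · rw [injective_iff_map_eq_zero]
    intro f hf
    rw [toR_apply] at hf
    have h := w.indep _ _ hf
    ext g
    by_contra hg
    exact hg (h g (Finsupp.mem_support_iff.mpr hg))
  · intro x
    induction x using span_induction w with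
    | h0 => exact ⟨0, map_zero _⟩
    | hadd x y hx hy =>
      obtain ⟨a, rfl⟩ := hx
      obtain ⟨b, rfl⟩ := hy
      exact ⟨a + b, map_add _ _ _⟩
    | hins g a => exact ⟨_, toR_single w g a⟩

theorem exists_shift (w : IsAlgCrossedProduct G A τ R) :
    ∃ L : G → R →ₗ[ℂ] R, ∀ g h a, L g (w.ins h a) = w.ins (g * h) a := by
  let e := LinearEquiv.ofBijective (toR w) (toR_bijective w)
  refine ⟨fun g => toR w ∘ₗ Finsupp.lmapDomain A ℂ (fun h => g * h) ∘ₗ e.symm.toLinearMap, ?_⟩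
  intro g h a
  have : e.symm (w.ins h a) = Finsupp.single h a := by
    rw [LinearEquiv.symm_apply_eq]
    exact (toR_single w h a).symm
  simp [this, toR_single]

section shift

variable (w : IsAlgCrossedProduct G A τ R) {L : G → R →ₗ[ℂ] R}

theorem shift_one (hL : ∀ g h a, L g (w.ins h a) = w.ins (g * h) a)
    (x : R) : L 1 x = x := by
  induction x using span_induction w with
  | h0 => simp
  | hadd x y hx hy => simp [hx, hy]
  | hins g a => simp [hL]

theorem shift_mul (hL : ∀ g h a, L g (w.ins h a) = w.ins (g * h) a)
    (g h : G) (x : R) : L g (L h x) = L (g * h) x := by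
  induction x using span_induction w with
  | h0 => simp
  | hadd x y hx hy => simp [hx, hy]
  | hins k a => simp [hL, mul_assoc]

theorem shift_star_mul (hL : ∀ g h a, L g (w.ins h a) = w.ins (g * h) a)
    (g : G) (x y : R) : star (L g x) * y = star x * L g⁻¹ y := by
  induction x using span_induction w with
  | h0 => simp
  | hadd x y hx hy => simp [add_mul, hx, hy]
  | hins h a =>
    induction y using span_induction w with
    | h0 => simp
    | hadd x y hx hy => simp [mul_add, hx, hy]
    | hins k b => simp [hL, w.ins_star, w.ins_mul, τ.mul_act, mul_assoc]

end shift

theorem multiplier_ext {D : Type} [NonUnitalCStarAlgebra D] {a b : 𝓜(ℂ, D)}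
    (h : ∀ x, a.fst x = b.fst x) : a = b := by
  rw [← sub_eq_zero, ← norm_eq_zero, ← DoubleCentralizer.norm_fst, norm_eq_zero,
    DoubleCentralizer.sub_fst, sub_eq_zero]
  exact ContinuousLinearMap.ext h

/-- A family of operators with an adjoint relation gives multipliers. -/
def mkMult {D : Type} [NonUnitalCStarAlgebra D] (U V : D →L[ℂ] D)
    (h : ∀ x y, star (V x) * y = star x * U y) : 𝓜(ℂ, D) where
  fst := U
  snd := ((((starₗᵢ ℂ : D ≃ₗᵢ⋆[ℂ] D) : D →L⋆[ℂ] D).comp V).comp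
    ((starₗᵢ ℂ : D ≃ₗᵢ⋆[ℂ] D) : D →L⋆[ℂ] D))
  central x y := by
    have := h (star x) y
    rw [star_star] at this
    exact this

theorem exists_covariant {D : Type} [NonUnitalCStarAlgebra D]
    (w : IsAlgCrossedProduct G A τ R) (φ : R →⋆ₙₐ[ℂ] D) (hd : DenseRange φ) :
    ∃ (ρ : A →⋆ₙₐ[ℂ] D) (μ : G →* unitary 𝓜(ℂ, D)),
      IsCovariantPair τ ρ μ ∧
      (∀ (g : G) (a : A),
        ((φ (w.ins g a) : D) : 𝓜(ℂ, D)) = (μ g : 𝓜(ℂ, D)) * ((ρ a : D) : 𝓜(ℂ, D))) := by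
  obtain ⟨L, hL⟩ := exists_shift w
  let e : R →ₗ[ℂ] D := (φ : R →ₗ[ℂ] D)
  have he : ∀ x, e x = φ x := fun _ => rfl
  have hde : DenseRange e := hd
  have hnorm : ∀ g x, ‖φ (L g x)‖ ≤ 1 * ‖φ x‖ := by
    intro g x
    have h1 : ‖φ (L g x)‖ * ‖φ (L g x)‖ = ‖φ x‖ * ‖φ x‖ := by
      rw [← CStarRing.norm_star_mul_self, ← CStarRing.norm_star_mul_self, ← map_star, ← map_mul,
        shift_star_mul w hL, shift_mul w hL, inv_mul_cancel, shift_one w hL, map_mul, map_star]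
    rw [one_mul]
    exact (mul_self_inj (norm_nonneg _) (norm_nonneg _)).mp h1 |>.le
  let U : G → D →L[ℂ] D := fun g => (e ∘ₗ L g).extendOfNorm e
  have hU : ∀ g x, U g (φ x) = φ (L g x) := fun g x =>
    LinearMap.extendOfNorm_eq hde ⟨1, hnorm g⟩ x
  have hUmul : ∀ g h x, U g (U h x) = U (g * h) x := by
    intro g h x
    refine hd.induction_on (p := fun x => U g (U h x) = U (g * h) x) x
      (isClosed_eq (by fun_prop) (by fun_prop)) ?_
    intro x
    simp only [hU, shift_mul w hL]
  have hUone : ∀ x, U 1 x = x := by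
    intro x
    refine hd.induction_on (p := fun x => U 1 x = x) x
      (isClosed_eq (by fun_prop) (by fun_prop)) ?_
    intro x
    simp only [hU, shift_one w hL]
  have hUadj : ∀ g x y, star (U g⁻¹ x) * y = star x * U g y := by
    intro g x y
    refine hd.induction_on (p := fun x => star (U g⁻¹ x) * y = star x * U g y) x
      (isClosed_eq (by fun_prop) (by fun_prop)) ?_
    intro x
    refine hd.induction_on (p := fun y => star (U g⁻¹ (φ x)) * y = star (φ x) * U g y) y
      (isClosed_eq (by fun_prop) (by fun_prop)) ?_
    intro y
    rw [hU, hU, ← map_star, ← map_mul, shift_star_mul w hL, inv_inv, map_mul, map_star]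
  let m : G → 𝓜(ℂ, D) := fun g => mkMult (U g) (U g⁻¹) (hUadj g)
  have hm : ∀ g x, (m g).fst x = U g x := fun _ _ => rfl
  have hmmul : ∀ g h, m (g * h) = m g * m h := by
    intro g h
    refine multiplier_ext fun x => ?_
    rw [DoubleCentralizer.mul_fst]
    exact (hUmul g h x).symm
  have hmone : m 1 = 1 := by
    refine multiplier_ext fun x => ?_
    rw [DoubleCentralizer.one_fst]
    exact hUone x
  have hmstar : ∀ g, star (m g) = m g⁻¹ := by
    intro g
    refine multiplier_ext fun x => ?_
    rw [DoubleCentralizer.star_fst]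
    change star (star (U g⁻¹ (star (star x)))) = U g⁻¹ x
    rw [star_star, star_star]
  let μ : G →* unitary 𝓜(ℂ, D) :=
    { toFun := fun g => ⟨m g, by
        rw [Unitary.mem_iff, hmstar, ← hmmul, ← hmmul]
        simp [hmone]⟩
      map_one' := Subtype.ext hmone
      map_mul' := fun g h => Subtype.ext (hmmul g h) }
  have hμ : ∀ g, (μ g : 𝓜(ℂ, D)) = m g := fun _ => rfl
  let ρ : A →⋆ₙₐ[ℂ] D :=
    { toFun := fun a => φ (w.ins 1 a)
      map_smul' := fun c a => by simp [w.ins_smul]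
      map_zero' := by
        have := (insₗ w 1).map_zero
        change φ (insₗ w 1 0) = 0
        rw [this, map_zero]
      map_add' := fun a b => by simp [w.ins_add]
      map_mul' := fun a b => by simp [← map_mul, w.ins_mul, τ.one_act]
      map_star' := fun a => by simp [← map_star, w.ins_star, τ.one_act] }
  have hρ : ∀ a, ρ a = φ (w.ins 1 a) := fun _ => rfl
  have key : ∀ (g : G) (a : A),
      ((φ (w.ins g a) : D) : 𝓜(ℂ, D)) = (μ g : 𝓜(ℂ, D)) * ((ρ a : D) : 𝓜(ℂ, D)) := by
    intro g a
    refine multiplier_ext fun x => ?_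
    rw [DoubleCentralizer.mul_fst]
    change φ (w.ins g a) * x = U g (φ (w.ins 1 a) * x)
    refine hd.induction_on (p := fun x => φ (w.ins g a) * x = U g (φ (w.ins 1 a) * x)) x
      (isClosed_eq (by fun_prop) (by fun_prop)) ?_
    intro x
    rw [← map_mul, ← map_mul, hU]
    congr 1
    induction x using span_induction w with
    | h0 => simp
    | hadd x y hx hy => simp [mul_add, hx, hy]
    | hins k b => simp [hL, w.ins_mul]
  refine ⟨ρ, μ, ?_, key⟩
  intro g a
  rw [← key]
  refine multiplier_ext fun x => ?_
  rw [DoubleCentralizer.mul_fst]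
  change φ (w.ins g a) * U g⁻¹ x = φ (w.ins 1 (τ.act g a)) * x
  refine hd.induction_on
    (p := fun x => φ (w.ins g a) * U g⁻¹ x = φ (w.ins 1 (τ.act g a)) * x) x
    (isClosed_eq (by fun_prop) (by fun_prop)) ?_
  intro x
  rw [hU, ← map_mul, ← map_mul]
  congr 1
  induction x using span_induction w with
  | h0 => simp
  | hadd x y hx hy => simp [mul_add, hx, hy]
  | hins k b => simp [hL, w.ins_mul, τ.mul_act]

/-- Every representation can be corestricted to a C*-algebra in which it has dense range. -/
theorem exists_dense {B : Type} [NonUnitalCStarAlgebra B] (φ : R →⋆ₙₐ[ℂ] B) :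
    ∃ (D : Type) (_ : NonUnitalCStarAlgebra D) (ψ : R →⋆ₙₐ[ℂ] D),
      DenseRange ψ ∧ ∀ x, ‖ψ x‖₊ = ‖φ x‖₊ := by
  let S : NonUnitalStarSubalgebra ℂ B := (NonUnitalStarAlgHom.range φ).topologicalClosure
  have hS : IsClosed (S : Set B) := NonUnitalStarSubalgebra.isClosed_topologicalClosure _
  have hmem : ∀ x, φ x ∈ S := fun x =>
    NonUnitalStarSubalgebra.le_topologicalClosure _ ⟨x, rfl⟩
  refine ⟨S, NonUnitalStarSubalgebra.nonUnitalCStarAlgebra S,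
    NonUnitalStarAlgHom.codRestrict φ S hmem, ?_, fun x => rfl⟩
  intro y
  rw [closure_subtype]
  have hy : (y : B) ∈ closure (Set.range φ) := y.2
  refine closure_mono ?_ hy
  rintro _ ⟨x, rfl⟩
  exact ⟨⟨φ x, hmem x⟩, ⟨x, rfl⟩, rfl⟩

end CrossedAux

/-- Let `A` be a possibly non-unital C*-algebra with an action of a
group `G`.  Then the canonical homomorphism `A ⋊ G → A ⋊^{C*} G`, from the completion of
`A ⋊^alg G` in the maximal semi-norm to the classical maximal crossed product, is an
isomorphism of C*-algebras; equivalently, the norms `‖·‖_max` and `‖·‖_{C*}` coincide on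
`A ⋊^alg G`. -/
theorem maxNorm_eq_cstarNorm_on_algebraic_crossed_product
    (G : Type) [Group G] (A : Type) [NonUnitalCStarAlgebra A] (τ : AlgGAction G A)
    (R : Type) [NonUnitalRing R] [Module ℂ R] [SMulCommClass ℂ R R]
    [IsScalarTower ℂ R R] [StarRing R] [StarModule ℂ R]
    (w : IsAlgCrossedProduct G A τ R) :
    ∀ x : R, cstarSeminorm τ w x = algMaxNorm R x := by
  intro x
  apply le_antisymm
  · refine sSup_le ?_
    rintro r ⟨D, iD, ρ, μ, σ, -, -, rfl⟩
    exact le_sSup ⟨D, iD, σ, rfl⟩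
  · refine sSup_le ?_
    rintro r ⟨B, iB, φ, rfl⟩
    obtain ⟨D, iD, ψ, hd, hn⟩ := CrossedAux.exists_dense φ
    obtain ⟨ρ, μ, hc, hk⟩ := CrossedAux.exists_covariant w ψ hd
    refine le_sSup ⟨D, iD, ρ, μ, ψ, hc, hk, ?_⟩
    rw [hn]
    rfl
end
end

section
/- For every possibly non-unital small C*-category C, the canonical functor ρ_C : C → A(C), sending each morphism f to the element [f] of A(C), is isometric on all morphism spaces. -/
noncomputable section

open scoped ENNReal

/-- `A`, together with the family `ι` (sending a morphism `f` to the element `[f]`), is a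
realization of the ∗-algebra `A^alg(C)`: the direct sum `⊕_{X,Y ∈ Ob(C)} Hom_C(X, Y)`,
with product `[g][f] = [g ∘ f]` when the morphisms are composable and `0` otherwise, and
involution `[f]* = [f*]`. -/
structure IsAAlg (C : StarCatNu) (A : Type) [NonUnitalRing A] [Module ℂ A]
    [SMulCommClass ℂ A A] [IsScalarTower ℂ A A] [StarRing A] [StarModule ℂ A] where
  ι : ∀ {X Y : C.Obj}, C.Hom X Y → A
  ι_add : ∀ (X Y : C.Obj) (f f' : C.Hom X Y), ι (f + f') = ι f + ι f'
  ι_smul : ∀ (X Y : C.Obj) (c : ℂ) (f : C.Hom X Y), ι (c • f) = c • ι f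
  ι_mul_comp : ∀ (X Y Z : C.Obj) (g : C.Hom Y Z) (f : C.Hom X Y),
    ι g * ι f = ι (C.comp g f)
  ι_mul_ne : ∀ (X Y X' Y' : C.Obj) (g : C.Hom X' Y') (f : C.Hom X Y),
    Y ≠ X' → ι g * ι f = 0
  ι_star : ∀ (X Y : C.Obj) (f : C.Hom X Y), star (ι f) = ι (C.star f)
  span : ∀ a : A, ∃ (s : Finset (C.Obj × C.Obj)) (φ : ∀ p : C.Obj × C.Obj, C.Hom p.1 p.2),
    a = s.sum fun p => ι (φ p)
  indep : ∀ (s : Finset (C.Obj × C.Obj)) (φ : ∀ p : C.Obj × C.Obj, C.Hom p.1 p.2),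
    (s.sum fun p => ι (φ p)) = 0 → ∀ p ∈ s, φ p = 0

section Helpers

open scoped ComplexOrder InnerProductSpace

/-- A norm-one functional taking the value one at the unit is positive. -/
theorem aux_nonneg_of_norm_le_one {D : Type} [CStarAlgebra D] [PartialOrder D] [StarOrderedRing D]
    (g : D →L[ℂ] ℂ) (hg : ‖g‖ ≤ 1) (h1 : g 1 = 1) (a : D) (ha : 0 ≤ a) : 0 ≤ g a := by
  have hsa : IsSelfAdjoint a := .of_nonneg ha
  have hbd : ∀ x : D, ‖g x‖ ≤ ‖x‖ := fun x => by
    simpa using g.le_of_opNorm_le hg x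
  rw [Complex.nonneg_iff]
  constructor
  · -- real part
    have hle : ‖algebraMap ℝ D ‖a‖ - a‖ ≤ ‖a‖ := by
      have h0 : 0 ≤ algebraMap ℝ D ‖a‖ - a := sub_nonneg.mpr hsa.le_algebraMap_norm_self
      rw [CStarAlgebra.norm_le_iff_le_algebraMap _ (norm_nonneg a) h0]
      exact sub_le_self _ ha
    have h2 := (hbd _).trans hle
    have h3 : g (algebraMap ℝ D ‖a‖ - a) = (‖a‖ : ℂ) - g a := by
      rw [map_sub, Algebra.algebraMap_eq_smul_one, ← Complex.coe_smul, map_smul, h1]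
      simp
    rw [h3] at h2
    have h4 := (Complex.re_le_norm _).trans h2
    simp at h4
    exact h4
  · -- imaginary part
    have key : ∀ t : ℝ, ((g a).im + t) ^ 2 ≤ ‖a‖ ^ 2 + t ^ 2 := by
      intro t
      have hx := hbd (a + (Complex.I * t) • (1 : D))
      have h3 : g (a + (Complex.I * t) • (1 : D)) = g a + Complex.I * t := by
        rw [map_add, map_smul, h1]; simp
      rw [h3] at hx
      have h4 := (Complex.abs_im_le_norm _).trans hx
      have h5 : (g a + Complex.I * t).im = (g a).im + t := by simp
      rw [h5] at h4
      have h6 : ((g a).im + t) ^ 2 ≤ ‖a + (Complex.I * t) • (1 : D)‖ ^ 2 := by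
        rw [← sq_abs]; gcongr
      refine h6.trans ?_
      rw [sq, ← CStarRing.norm_star_mul_self]
      have h7 : star (a + (Complex.I * t) • (1 : D)) * (a + (Complex.I * t) • (1 : D))
          = a * a + ((t ^ 2 : ℝ) : ℂ) • (1 : D) := by
        simp only [star_add, star_smul, hsa.star_eq, star_one, add_mul, mul_add, smul_mul_assoc,
          mul_smul_comm, one_mul, mul_one]
        simp only [star_mul', Complex.star_def, Complex.conj_I, Complex.conj_ofReal]
        have : Complex.I * (t : ℂ) * (-Complex.I * t) = ((t ^ 2 : ℝ) : ℂ) := by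
          push_cast
          linear_combination (-(t : ℂ) ^ 2) * Complex.I_sq
        rw [mul_comm] at this
        rw [← this]
        simp only [neg_mul, neg_smul, smul_add, smul_neg, smul_smul]
        abel
      rw [h7]
      refine (norm_add_le _ _).trans ?_
      gcongr
      · exact (norm_mul_le _ _).trans_eq (sq _).symm
      · rw [norm_smul]
        have : ‖(1 : D)‖ ≤ 1 := by
          rcases subsingleton_or_nontrivial D with h | h
          · simp [Subsingleton.elim (1 : D) 0]
          · simp
        have h8 : ‖((t ^ 2 : ℝ) : ℂ)‖ = t ^ 2 := by simp
        rw [h8]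
        nlinarith [sq_nonneg t]
    by_contra hne
    have hne' : (g a).im ≠ 0 := fun h => hne h.symm
    have := key (‖a‖ ^ 2 / (2 * (g a).im))
    have h9 : (g a).im * (‖a‖ ^ 2 / (2 * (g a).im)) = ‖a‖ ^ 2 / 2 := by
      field_simp
    have : 0 < (g a).im ^ 2 := by positivity
    nlinarith

/-- States attaining the norm of a positive element. -/
theorem aux_exists_state {D : Type} [CStarAlgebra D] [PartialOrder D] [StarOrderedRing D]
    [Nontrivial D] (b : D) (hb : 0 ≤ b) (hb0 : b ≠ 0) :
    ∃ φ : D →ₚ[ℂ] ℂ, φ 1 = 1 ∧ φ b = ‖b‖ := by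
  have hpos : 0 < ‖b‖ := norm_pos_iff.mpr hb0
  have hn : ‖algebraMap ℝ D ‖b‖ + b‖ = 2 * ‖b‖ := by
    apply le_antisymm
    · refine (norm_add_le _ _).trans ?_
      rw [norm_algebraMap']; simp; linarith
    · have h := CStarAlgebra.norm_mem_spectrum_of_nonneg hb
      have h2 := (spectrum.add_mem_add_iff (s := ‖b‖)).mpr h
      have h3 := spectrum.norm_le_norm_of_mem h2
      rw [Real.norm_of_nonneg (by positivity)] at h3
      linarith
  obtain ⟨g, hg, hgx⟩ := exists_dual_vector'' ℂ (algebraMap ℝ D ‖b‖ + b)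
  have hbd : ∀ x : D, ‖g x‖ ≤ ‖x‖ := fun x => by
    simpa using g.le_of_opNorm_le hg x
  rw [hn, map_add, Algebra.algebraMap_eq_smul_one, ← Complex.coe_smul, map_smul] at hgx
  have hg1 := hbd 1
  have hgb := hbd b
  rw [norm_one] at hg1
  have hre : ‖b‖ * (g 1).re + (g b).re = 2 * ‖b‖ := by
    have := congrArg Complex.re hgx
    simpa using this
  have e1 := (Complex.re_le_norm _).trans hg1
  have e2 := (Complex.re_le_norm _).trans hgb
  have r1 : (g 1).re = 1 := by nlinarith
  have r2 : (g b).re = ‖b‖ := by nlinarith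
  have c1 : g 1 = 1 := by
    have hn := hg1
    have h2 : ‖g 1‖ ^ 2 ≤ 1 := by nlinarith [norm_nonneg (g 1)]
    rw [Complex.sq_norm, Complex.normSq_apply, r1] at h2
    apply Complex.ext
    · simpa using r1
    · have : (g 1).im ^ 2 ≤ 0 := by nlinarith
      simpa using pow_eq_zero_iff (two_ne_zero) |>.mp (le_antisymm this (sq_nonneg _))
  have c2 : g b = ‖b‖ := by
    rw [c1] at hgx
    simp only [smul_eq_mul, mul_one] at hgx
    push_cast at hgx
    linear_combination hgx
  exact ⟨PositiveLinearMap.mk₀ g.toLinearMap (fun a ha =>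
    aux_nonneg_of_norm_le_one g hg c1 a ha), c1, c2⟩

/-- Every element of a C*-algebra is normed by a representation on a Hilbert space. -/
theorem aux_exists_rep (B : Type) [NonUnitalCStarAlgebra B] (a : B) :
    ∃ (H : Type) (_ : NormedAddCommGroup H) (_ : InnerProductSpace ℂ H) (_ : CompleteSpace H)
      (π : B →⋆ₙₐ[ℂ] (H →L[ℂ] H)), ‖a‖ ≤ ‖π a‖ := by
  by_cases ha : a = 0
  · subst ha
    exact ⟨ℂ, inferInstance, inferInstance, inferInstance, 0, by simp⟩
  let _ : PartialOrder (Unitization ℂ B) := CStarAlgebra.spectralOrder _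
  have _ : StarOrderedRing (Unitization ℂ B) := CStarAlgebra.spectralOrderedRing _
  set x : Unitization ℂ B := (a : Unitization ℂ B) with hx
  have hxn : ‖x‖ = ‖a‖ := Unitization.norm_inr (𝕜 := ℂ) a
  have hx0 : x ≠ 0 := by
    rw [← norm_ne_zero_iff, hxn]; exact norm_ne_zero_iff.mpr ha
  obtain ⟨φ, h1, h2⟩ := aux_exists_state (star x * x) (star_mul_self_nonneg x)
    (by rwa [Ne, CStarRing.star_mul_self_eq_zero_iff])
  refine ⟨φ.GNS, inferInstance, inferInstance, inferInstance,
    φ.gnsNonUnitalStarAlgHom.comp (Unitization.inrNonUnitalStarAlgHom ℂ B), ?_⟩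
  have hv : ‖((φ.toPreGNS 1 : φ.PreGNS) : φ.GNS)‖ = 1 := by
    rw [UniformSpace.Completion.norm_coe, PositiveLinearMap.preGNS_norm_def]
    simp [h1]
  have hw : ‖((φ.toPreGNS x : φ.PreGNS) : φ.GNS)‖ = ‖x‖ := by
    rw [UniformSpace.Completion.norm_coe, PositiveLinearMap.preGNS_norm_def]
    simp [h2, CStarRing.norm_star_mul_self]
  have hop := (φ.gnsNonUnitalStarAlgHom x).le_opNorm ((φ.toPreGNS 1 : φ.PreGNS) : φ.GNS)
  rw [hv, mul_one, PositiveLinearMap.gnsNonUnitalStarAlgHom_apply_coe] at hop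
  have he : φ.leftMulMapPreGNS x (φ.toPreGNS 1) = φ.toPreGNS x := by
    simp
  rw [he, hw, hxn] at hop
  exact hop

/-- Amplification of a Hilbert space by orthogonal copies of itself. -/
theorem aux_exists_amplification (O : Type) (H : Type) [NormedAddCommGroup H]
    [InnerProductSpace ℂ H] [CompleteSpace H] :
    ∃ (K : Type) (_ : NormedAddCommGroup K) (_ : InnerProductSpace ℂ K) (_ : CompleteSpace K)
      (V : O → (H →L[ℂ] K)), (∀ X, ‖V X‖ ≤ 1) ∧
      (∀ X, (ContinuousLinearMap.adjoint (V X)) ∘L V X = ContinuousLinearMap.id ℂ H) ∧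
      (∀ X Y, X ≠ Y → (ContinuousLinearMap.adjoint (V X)) ∘L V Y = 0) := by
  classical
  refine ⟨lp (fun _ : O => H) 2, inferInstance, inferInstance, inferInstance,
    fun X => lp.singleContinuousLinearMap ℂ (fun _ : O => H) 2 X, ?_, ?_, ?_⟩
  · intro X
    refine ContinuousLinearMap.opNorm_le_bound _ zero_le_one fun x => ?_
    rw [one_mul]
    exact (lp.norm_single (E := fun _ : O => H) (p := 2) (by norm_num) X x).le
  · intro X
    ext v
    refine ext_inner_left ℂ fun u => ?_
    rw [ContinuousLinearMap.comp_apply, ContinuousLinearMap.adjoint_inner_right]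
    refine (lp.inner_single_left (G := fun _ : O => H) X u _).trans ?_
    exact congrArg (fun z => ⟪u, z⟫_ℂ) (lp.single_apply_self (E := fun _ : O => H) 2 X v)
  · intro X Y hXY
    ext v
    refine ext_inner_left ℂ fun u => ?_
    rw [ContinuousLinearMap.comp_apply, ContinuousLinearMap.adjoint_inner_right]
    refine (lp.inner_single_left (G := fun _ : O => H) X u _).trans ?_
    exact congrArg (fun z => ⟪u, z⟫_ℂ) (lp.single_apply_ne (E := fun _ : O => H) 2 Y v hXY)

end Helpers

section Assembly

open scoped ComplexOrder InnerProductSpace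

/-- Universal property of `A^alg(C)`: a linear family `T` extends to a linear map. -/
theorem aux_exists_linear_extension (C : StarCatNu)
    (A : Type) [NonUnitalRing A] [Module ℂ A] [SMulCommClass ℂ A A]
    [IsScalarTower ℂ A A] [StarRing A] [StarModule ℂ A] (w : IsAAlg C A)
    (M : Type) [AddCommGroup M] [Module ℂ M]
    (T : ∀ p : C.Obj × C.Obj, C.Hom p.1 p.2 →ₗ[ℂ] M) :
    ∃ Φ : A →ₗ[ℂ] M, ∀ (X Y : C.Obj) (f : C.Hom X Y), Φ (w.ι f) = T (X, Y) f := by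
  classical
  let I : ∀ p : C.Obj × C.Obj, C.Hom p.1 p.2 →ₗ[ℂ] A := fun p =>
    { toFun := fun f => w.ι f
      map_add' := w.ι_add p.1 p.2
      map_smul' := w.ι_smul p.1 p.2 }
  let L : (Π₀ p : C.Obj × C.Obj, C.Hom p.1 p.2) →ₗ[ℂ] A := DFinsupp.lsum ℂ I
  have hLs : ∀ (p : C.Obj × C.Obj) (f : C.Hom p.1 p.2), L (DFinsupp.single p f) = w.ι f := by
    intro p f
    exact DFinsupp.lsum_single ℂ I p f
  have hinj : Function.Injective L := by
    rw [injective_iff_map_eq_zero]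
    intro x hx
    have hsum : L x = x.support.sum fun p => w.ι (x p) := by
      conv_lhs => rw [← DFinsupp.sum_single (f := x)]
      rw [DFinsupp.sum, map_sum]
      exact Finset.sum_congr rfl fun p _ => hLs p _
    have h0 := w.indep x.support (fun p => x p) (hsum.symm.trans hx)
    ext p
    by_cases hp : p ∈ x.support
    · exact h0 p hp
    · simpa using hp
  have hsurj : Function.Surjective L := by
    intro a
    obtain ⟨s, φ, rfl⟩ := w.span a
    refine ⟨∑ p ∈ s, DFinsupp.single p (φ p), ?_⟩
    rw [map_sum]
    exact Finset.sum_congr rfl fun p _ => hLs p _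
  let e := LinearEquiv.ofBijective L ⟨hinj, hsurj⟩
  refine ⟨(DFinsupp.lsum ℂ T) ∘ₗ e.symm.toLinearMap, fun X Y f => ?_⟩
  have he : e.symm (w.ι f) = DFinsupp.single (X, Y) f := by
    rw [LinearEquiv.symm_apply_eq]
    exact (hLs (X, Y) f).symm
  rw [LinearMap.comp_apply, LinearEquiv.coe_coe, he]
  exact DFinsupp.lsum_single ℂ T (X, Y) f

/-- Multiplicative version of the universal property. -/
theorem aux_exists_hom (C : StarCatNu)
    (A : Type) [NonUnitalRing A] [Module ℂ A] [SMulCommClass ℂ A A]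
    [IsScalarTower ℂ A A] [StarRing A] [StarModule ℂ A] (w : IsAAlg C A)
    (M : Type) [NonUnitalCStarAlgebra M]
    (T : ∀ X Y : C.Obj, C.Hom X Y →ₗ[ℂ] M)
    (hcomp : ∀ (X Y Z : C.Obj) (g : C.Hom Y Z) (f : C.Hom X Y),
      T Y Z g * T X Y f = T X Z (C.comp g f))
    (hne : ∀ (X Y X' Y' : C.Obj) (g : C.Hom X' Y') (f : C.Hom X Y), Y ≠ X' →
      T X' Y' g * T X Y f = 0)
    (hstar : ∀ (X Y : C.Obj) (f : C.Hom X Y), star (T X Y f) = T Y X (C.star f)) :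
    ∃ Φ : A →⋆ₙₐ[ℂ] M, ∀ (X Y : C.Obj) (f : C.Hom X Y), Φ (w.ι f) = T X Y f := by
  obtain ⟨Φ, hΦ⟩ := aux_exists_linear_extension C A w M (fun p => T p.1 p.2)
  have hmulι : ∀ (X Y X' Y' : C.Obj) (g : C.Hom X' Y') (f : C.Hom X Y),
      Φ (w.ι g * w.ι f) = Φ (w.ι g) * Φ (w.ι f) := by
    intro X Y X' Y' g f
    by_cases h : Y = X'
    · subst h
      rw [w.ι_mul_comp, hΦ, hΦ, hΦ, hcomp]
    · rw [w.ι_mul_ne _ _ _ _ _ _ h, hΦ, hΦ, hne _ _ _ _ _ _ h, map_zero]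
  have hmul : ∀ a b : A, Φ (a * b) = Φ a * Φ b := by
    intro a b
    obtain ⟨s, φ, rfl⟩ := w.span a
    obtain ⟨t, ψ, rfl⟩ := w.span b
    simp only [Finset.sum_mul, Finset.mul_sum, map_sum, hmulι]
  have hst : ∀ a : A, Φ (star a) = star (Φ a) := by
    intro a
    obtain ⟨s, φ, rfl⟩ := w.span a
    simp only [star_sum, map_sum, w.ι_star, hΦ, hstar]
  exact ⟨{ toFun := Φ
           map_smul' := fun c x => map_smul Φ c x
           map_zero' := map_zero Φ
           map_add' := map_add Φ
           map_mul' := hmul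
           map_star' := hst }, hΦ⟩

theorem aux_le (C : StarCatNu)
    (A : Type) [NonUnitalRing A] [Module ℂ A] [SMulCommClass ℂ A A]
    [IsScalarTower ℂ A A] [StarRing A] [StarModule ℂ A] (w : IsAAlg C A)
    (X Y : C.Obj) (f : C.Hom X Y) : algMaxNorm A (w.ι f) ≤ C.maxNorm f := by
  refine sSup_le ?_
  rintro r ⟨B, i, φ, rfl⟩
  refine le_sSup ⟨B, i, ?_, ?_⟩
  · exact
      { obj := fun _ => PUnit.unit
        map := fun {X Y} f => φ (w.ι f)
        map_add := fun X Y f f' => by rw [w.ι_add, map_add]; rfl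
        map_smul := fun X Y c f => by rw [w.ι_smul, map_smul]; rfl
        map_comp := fun X Y Z g f => by rw [← w.ι_mul_comp, map_mul]; rfl
        map_star := fun X Y f => by rw [← w.ι_star, map_star]; rfl }
  · rfl

theorem aux_ge (C : StarCatNu)
    (A : Type) [NonUnitalRing A] [Module ℂ A] [SMulCommClass ℂ A A]
    [IsScalarTower ℂ A A] [StarRing A] [StarModule ℂ A] (w : IsAAlg C A)
    (X Y : C.Obj) (f : C.Hom X Y) : C.maxNorm f ≤ algMaxNorm A (w.ι f) := by
  refine sSup_le ?_
  rintro r ⟨B, i, ρ, rfl⟩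
  let R : ∀ X Y : C.Obj, C.Hom X Y →ₗ[ℂ] B := fun X Y =>
    { toFun := fun f => ρ.map f
      map_add' := ρ.map_add X Y
      map_smul' := ρ.map_smul X Y }
  have hRc : ∀ (X Y Z : C.Obj) (g : C.Hom Y Z) (f : C.Hom X Y),
      R X Z (C.comp g f) = R Y Z g * R X Y f := fun X Y Z g f => ρ.map_comp X Y Z g f
  have hRs : ∀ (X Y : C.Obj) (f : C.Hom X Y), R Y X (C.star f) = star (R X Y f) :=
    fun X Y f => ρ.map_star X Y f
  obtain ⟨H, _, _, _, π, hπ⟩ := aux_exists_rep B (R X Y f)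
  obtain ⟨K, _, _, _, V, hV1, hVV, hV0⟩ := aux_exists_amplification C.Obj H
  let T : ∀ X Y : C.Obj, C.Hom X Y →ₗ[ℂ] (K →L[ℂ] K) := fun X Y =>
    { toFun := fun f => V Y ∘L π (R X Y f) ∘L ContinuousLinearMap.adjoint (V X)
      map_add' := fun f g => by
        rw [map_add, map_add]; ext; simp
      map_smul' := fun c f => by
        rw [map_smul, map_smul]; ext; simp }
  have hT : ∀ (X Y : C.Obj) (f : C.Hom X Y),
      T X Y f = V Y ∘L π (R X Y f) ∘L ContinuousLinearMap.adjoint (V X) := fun _ _ _ => rfl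
  have hVV' : ∀ X v, ContinuousLinearMap.adjoint (V X) (V X v) = v := fun X v =>
    congrArg (fun S : H →L[ℂ] H => S v) (hVV X)
  have hV0' : ∀ X Y, X ≠ Y → ∀ v, ContinuousLinearMap.adjoint (V X) (V Y v) = 0 :=
    fun X Y h v => congrArg (fun S : H →L[ℂ] H => S v) (hV0 X Y h)
  obtain ⟨Φ, hΦ⟩ := aux_exists_hom C A w (K →L[ℂ] K) T
    (by
      intro X Y Z g f
      ext v
      simp [hT, hRc, hVV'])
    (by
      intro X Y X' Y' g f h
      ext v
      simp [hT, hV0' X' Y (Ne.symm h)])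
    (by
      intro X Y f
      rw [hT, hT, hRs, map_star, ContinuousLinearMap.star_eq_adjoint,
        ContinuousLinearMap.star_eq_adjoint, ContinuousLinearMap.adjoint_comp,
        ContinuousLinearMap.adjoint_comp, ContinuousLinearMap.adjoint_adjoint,
        ContinuousLinearMap.comp_assoc])
  refine le_trans ?_ (le_sSup ⟨K →L[ℂ] K, inferInstance, Φ, rfl⟩)
  have hb : ‖π (R X Y f)‖ ≤ ‖Φ (w.ι f)‖ := by
    refine ContinuousLinearMap.opNorm_le_bound _ (norm_nonneg _) fun v => ?_
    have hVn : ∀ X (v : H), ‖V X v‖ ≤ ‖v‖ := fun X v => by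
      simpa using (V X).le_of_opNorm_le (hV1 X) v
    have hAn : ∀ X (u : K), ‖ContinuousLinearMap.adjoint (V X) u‖ ≤ ‖u‖ := fun X u => by
      have h : ‖ContinuousLinearMap.adjoint (V X)‖ ≤ 1 := by
        rw [LinearIsometryEquiv.norm_map]; exact hV1 X
      simpa using (ContinuousLinearMap.adjoint (V X)).le_of_opNorm_le h u
    have h1 : π (R X Y f) v
        = ContinuousLinearMap.adjoint (V Y) (Φ (w.ι f) (V X v)) := by
      rw [hΦ, hT]
      simp [hVV']
    rw [h1]
    calc _ ≤ ‖Φ (w.ι f) (V X v)‖ := hAn _ _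
      _ ≤ ‖Φ (w.ι f)‖ * ‖V X v‖ := ContinuousLinearMap.le_opNorm _ _
      _ ≤ _ := by gcongr; exact hVn X v
  have hfin : ‖R X Y f‖ ≤ ‖Φ (w.ι f)‖ := hπ.trans hb
  have hfin' : ‖R X Y f‖₊ ≤ ‖Φ (w.ι f)‖₊ := hfin
  exact ENNReal.coe_le_coe.mpr hfin'

end Assembly

/-- For every possibly non-unital small C*-category `C`, the canonical
functor `ρ_C : C → A(C)` (sending a morphism `f` to the element `[f]` of `A^alg(C)`,
followed by the completion morphism `j : A^alg(C) → A(C)`) is isometric on all morphism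
spaces. -/
theorem canonical_functor_to_ACat_isometric
    (C : StarCatNu) (hC : IsCStar C)
    (A : Type) [NonUnitalRing A] [Module ℂ A] [SMulCommClass ℂ A A]
    [IsScalarTower ℂ A A] [StarRing A] [StarModule ℂ A] (w : IsAAlg C A)
    (A' : Type) [NonUnitalCStarAlgebra A'] (j : A →⋆ₙₐ[ℂ] A')
    (hj : IsAlgCompletion A A' j) :
    ∀ (X Y : C.Obj) (f : C.Hom X Y), (‖j (w.ι f)‖₊ : ℝ≥0∞) = C.maxNorm f := by
  intro X Y f
  rw [hj.isometric]
  exact le_antisymm (aux_le C A w X Y f) (aux_ge C A w X Y f)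
end
end
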